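/- arXiv:2508.05931 — 2 statements merged into one kernel-verified Lean document; each statement's English description precedes it below -/
import Mathlib

section
/- Let n be a positive integer, let E be an arbitrary subset of Euclidean space ℝⁿ, and let f : E → ℝⁿ be a continuous map such that f(x) ≠ 0 for every x in the interior of E (interior taken in ℝⁿ). Then for every ε > 0 there exists a continuous map g : E → ℝⁿ with g(x) ≠ 0 for every x ∈ E and sup_{x ∈ E} |f(x) − g(x)| < ε. -/
open Set Metric Filter Topology

universe u

theorem zf_radial {X : Type*} [NormedAddCommGroup X] [NormedSpace ℝ X] (c : X) (r : ℝ) (q : X)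
    (hq : q ∈ ball c r) : ∃ R : X → X, ContinuousOn R {q}ᶜ ∧ (∀ x ∉ closedBall c r, R x = x) ∧
      ∀ x ∈ closedBall c r, x ≠ q → R x ∈ sphere c r := by
  have hr : 0 < r := pos_of_mem_ball hq
  set s : Set X := ball (c - q) r with hs
  have h0 : (0 : X) ∈ s := by
    rw [hs, mem_ball, dist_eq_norm]
    rw [mem_ball, dist_eq_norm] at hq
    simpa [norm_sub_rev] using hq
  have hs0 : s ∈ 𝓝 (0 : X) := isOpen_ball.mem_nhds h0
  have hc : Convex ℝ s := convex_ball _ _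
  have hb : Bornology.IsVonNBounded ℝ s := NormedSpace.isVonNBounded_of_isBounded ℝ isBounded_ball
  have hcg := continuous_gauge hc hs0
  have hpos : ∀ x, x ≠ q → 0 < gauge s (x - q) := fun x hx =>
    (gauge_pos (absorbent_nhds_zero hs0) hb).2 (sub_ne_zero.2 hx)
  have hmem : ∀ x, x ∈ closedBall c r ↔ gauge s (x - q) ≤ 1 := by
    intro x
    rw [gauge_le_one_iff_mem_closure hc hs0, hs, closure_ball _ hr.ne', mem_closedBall,
      mem_closedBall, dist_eq_norm, dist_eq_norm]
    simp
  have hsph : ∀ x, x ∈ sphere c r ↔ gauge s (x - q) = 1 := by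
    intro x
    rw [gauge_eq_one_iff_mem_frontier hc hs0, hs, frontier_ball _ hr.ne', mem_sphere,
      mem_sphere, dist_eq_norm, dist_eq_norm]
    simp
  refine ⟨fun x => q + max 1 (gauge s (x - q))⁻¹ • (x - q), ?_, ?_, ?_⟩
  · refine continuousOn_const.add (ContinuousOn.smul ?_ (by fun_prop))
    refine (continuous_const.max continuous_id).comp_continuousOn
      (ContinuousOn.inv₀ (Continuous.continuousOn (by fun_prop)) ?_)
    intro x hx
    exact (hpos x hx).ne'
  · intro x hx
    rw [hmem, not_le] at hx
    have : (gauge s (x - q))⁻¹ ≤ 1 := inv_le_one_of_one_le₀ hx.le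
    simp [max_eq_left this]
  · intro x hx hxq
    rw [hmem] at hx
    have h1 : 1 ≤ (gauge s (x - q))⁻¹ := (one_le_inv₀ (hpos x hxq)).2 hx
    rw [hsph]
    simp only [max_eq_right h1, add_sub_cancel_left]
    rw [gauge_smul_of_nonneg (by positivity), smul_eq_mul]
    exact inv_mul_cancel₀ (hpos x hxq).ne'

theorem zf_push {X Y : Type*} [TopologicalSpace X] [TopologicalSpace Y] [Zero Y] (M : Set X)
    (F : X → Y) (hF : ContinuousOn F M) (B : ℕ → Set X) (R : ℕ → X → X)
    (hRc : ∀ k, ContinuousOn (R k) M) (hRM : ∀ k, MapsTo (R k) M M)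
    (hRid : ∀ k, ∀ x ∉ B k, R k x = x)
    (hRB : ∀ k, ∀ x ∈ B k, x ∈ M → R k x ∈ B k ∧ F (R k x) ≠ 0)
    (hfin : ∀ x ∈ M, ∃ N ∈ 𝓝 x, ∃ K : ℕ, ∀ k ≥ K, ∀ y ∈ N, y ∉ B k) :
    ∃ G : X → Y, ContinuousOn G M ∧ (∀ x ∈ M, (F x ≠ 0 ∨ ∃ k, x ∈ B k) → G x ≠ 0) ∧
      ∀ x ∈ M, G x = F x ∨ ((∃ k, x ∈ B k) ∧ ∃ y ∈ M, (∃ k, y ∈ B k) ∧ G x = F y) := by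
  let Fk : ℕ → X → Y := fun k => Nat.rec F (fun k G => G ∘ R k) k
  have F0 : Fk 0 = F := rfl
  have Fs : ∀ k x, Fk (k+1) x = Fk k (R k x) := fun k x => rfl
  have h1 : ∀ k, ContinuousOn (Fk k) M := by
    intro k
    induction k with
    | zero => exact hF
    | succ k ih => exact ih.comp (hRc k) (hRM k)
  have h2 : ∀ k, ∀ x ∈ M, (F x ≠ 0 ∨ ∃ i < k, x ∈ B i) → Fk k x ≠ 0 := by
    intro k
    induction k with
    | zero => 
      rintro x hx (h | ⟨i, hi, -⟩)
      · exact h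
      · omega
    | succ k ih =>
      intro x hx h
      rw [Fs]
      by_cases hxB : x ∈ B k
      · exact ih _ (hRM k hx) (Or.inl (hRB k x hxB hx).2)
      · rw [hRid k x hxB]
        refine ih x hx (h.imp id ?_)
        rintro ⟨i, hi, hxi⟩
        refine ⟨i, ?_, hxi⟩
        have : i ≠ k := by rintro rfl; exact hxB hxi
        omega
  have h3 : ∀ k, ∀ x ∈ M, Fk k x = F x ∨
      ((∃ k, x ∈ B k) ∧ ∃ y ∈ M, (∃ k, y ∈ B k) ∧ Fk k x = F y) := by
    intro k
    induction k with
    | zero => exact fun x hx => Or.inl rfl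
    | succ k ih =>
      intro x hx
      rw [Fs]
      by_cases hxB : x ∈ B k
      · right
        refine ⟨⟨k, hxB⟩, ?_⟩
        rcases ih _ (hRM k hx) with h | ⟨-, h⟩
        · exact ⟨_, hRM k hx, ⟨k, (hRB k x hxB hx).1⟩, h⟩
        · exact h
      · rw [hRid k x hxB]; exact ih x hx
  choose! N hN K hK using hfin
  have h4 : ∀ x ∈ M, ∀ y ∈ N x, ∀ k ≥ K x, Fk k y = Fk (K x) y := by
    intro x hx y hy k hk
    induction k, hk using Nat.le_induction with
    | base => rfl
    | succ k hk ih => rw [Fs, hRid k y (hK x hx k hk y hy), ih]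
  have h5 : ∀ x ∈ M, ∀ k ≥ K x, Fk k x = Fk (K x) x := fun x hx k hk =>
    h4 x hx x (mem_of_mem_nhds (hN x hx)) k hk
  refine ⟨fun x => Fk (K x) x, ?_, ?_, ?_⟩
  · intro x hx
    refine ((h1 (K x)) x hx).congr_of_eventuallyEq ?_ rfl
    filter_upwards [self_mem_nhdsWithin, mem_nhdsWithin_of_mem_nhds (hN x hx)] with y hyM hyN
    rw [← h5 y hyM (max (K x) (K y)) (le_max_right _ _), h4 x hx y hyN _ (le_max_left _ _)]
  · rintro x hx (h | ⟨k, hk⟩)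
    · exact h2 _ x hx (Or.inl h)
    · change Fk (K x) x ≠ 0
      rw [← h5 x hx (max (K x) (k+1)) (le_max_left _ _)]
      refine h2 _ x hx (Or.inr ⟨k, ?_, hk⟩)
      have := le_max_right (K x) (k+1)
      omega
  · intro x hx
    exact h3 _ x hx

/-- coarse extension -/
theorem zf_ext {X Y : Type*} [MetricSpace X] [NormedAddCommGroup Y] [NormedSpace ℝ Y]
    (E : Set X) (f : E → Y) (hf : Continuous f) (e : ℝ) (he : 0 < e) :
    ∃ U : TopologicalSpace.Opens X, E ⊆ U ∧ ∃ F : C(U, Y), ∀ x : U, ∀ h : x.1 ∈ E,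
      ‖F x - f ⟨x.1, h⟩‖ < e := by
  have h : ∀ x : E, ∃ W : Set X, IsOpen W ∧ x.1 ∈ W ∧ ∀ y : E, y.1 ∈ W → ‖f x - f y‖ < e := by
    intro x
    have : ∀ᶠ y in 𝓝 x, ‖f x - f y‖ < e := by
      have := (Metric.continuous_iff'.1 hf) x e he
      filter_upwards [this] with y hy
      rwa [dist_comm, dist_eq_norm] at hy
    obtain ⟨W, hW, hWo, hxW⟩ := _root_.eventually_nhds_iff.1 this
    obtain ⟨W', hW', rfl⟩ := isOpen_induced_iff.1 hWo
    exact ⟨W', hW', hxW, fun y hy => hW y hy⟩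
  choose W hWo hxW hW using h
  refine ⟨⟨⋃ x, W x, isOpen_iUnion hWo⟩, fun x hx => mem_iUnion.2 ⟨⟨x, hx⟩, hxW _⟩, ?_⟩
  refine exists_continuous_forall_mem_convex_of_local_const
    (t := fun x : (⟨⋃ x, W x, isOpen_iUnion hWo⟩ : TopologicalSpace.Opens X) =>
      {v | ∀ h : x.1 ∈ E, ‖v - f ⟨x.1, h⟩‖ < e}) ?_ ?_
  · intro x
    by_cases h : x.1 ∈ E
    · convert convex_ball (f ⟨x.1, h⟩) e using 1
      ext v
      simp [h, dist_eq_norm]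
    · convert convex_univ (𝕜 := ℝ) (E := Y) using 1
      ext v
      simp [h]
  · rintro ⟨x, hx⟩
    obtain ⟨z, hz⟩ := mem_iUnion.1 hx
    refine ⟨f z, ?_⟩
    have : ∀ᶠ y in 𝓝 x, y ∈ W z := (hWo z).mem_nhds hz
    filter_upwards [continuous_subtype_val.continuousAt.eventually this] with y hy h
    exact hW z ⟨y.1, h⟩ hy

/-- blending -/
theorem zf_blend {X Y : Type*} [MetricSpace X] [NormedAddCommGroup Y] [NormedSpace ℝ Y]
    (F0 f : X → Y) (hF0 : Continuous F0) (e : ℝ) (he : 0 < e) (T V : Set X) (hT : IsClosed T)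
    (hV : IsOpen V) (hTV : T ⊆ V) (hf : ContinuousOn f V) (hd : ∀ x ∈ V, ‖F0 x - f x‖ < e) :
    ∃ F1 : C(X, Y), ∀ x, ‖F1 x - F0 x‖ < e ∧ (x ∈ T → F1 x = f x) := by
  refine exists_continuous_forall_mem_convex_of_local
    (t := fun x => {v | ‖v - F0 x‖ < e ∧ (x ∈ T → v = f x)}) ?_ ?_
  · intro x
    have h1 : Convex ℝ {v | ‖v - F0 x‖ < e} := by
      convert convex_ball (F0 x) e using 1
      ext v
      simp [dist_eq_norm]
    have h2 : Convex ℝ {v | x ∈ T → v = f x} := ?_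
    · exact h1.inter h2
    by_cases h : x ∈ T
    · convert convex_singleton (𝕜 := ℝ) (f x) using 1
      ext v
      simp [h]
    · convert convex_univ (𝕜 := ℝ) (E := Y) using 1
      ext v
      simp [h]
  · intro x
    by_cases h : x ∈ T
    · refine ⟨V, hV.mem_nhds (hTV h), f, hf, fun y hy => ⟨?_, fun _ => rfl⟩⟩
      rw [norm_sub_rev]; exact hd y hy
    · refine ⟨Tᶜ, hT.isOpen_compl.mem_nhds h, F0, hF0.continuousOn, fun y hy => ⟨?_, ?_⟩⟩
      · simpa using he
      · exact fun h' => absurd h' hy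

open scoped Manifold ContDiff in
/-- perturbation avoiding zeros on a null set -/
theorem zf_perturb {X : Type*} [NormedAddCommGroup X] [NormedSpace ℝ X] [FiniteDimensional ℝ X]
    [MeasurableSpace X] [BorelSpace X] (μ : MeasureTheory.Measure X) [μ.IsAddHaarMeasure]
    (U : TopologicalSpace.Opens X)
    (F1 : C(U, X)) (e : ℝ) (he : 0 < e) (T : Set U) (hT : IsClosed T) (hT0 : ∀ x ∈ T, F1 x ≠ 0)
    (S : Set X) (hSU : S ⊆ U) (hS : μ S = 0) :
    ∃ F2 : C(U, X), (∀ x, ‖F2 x - F1 x‖ < e) ∧ (∀ x ∈ T, F2 x ≠ 0) ∧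
      ∀ x : U, x.1 ∈ S → F2 x ≠ 0 := by
  obtain ⟨δ, hδ⟩ : ∃ δ : C(U, ℝ), ∀ x, 0 < δ x ∧ δ x < e ∧ (x ∈ T → δ x < ‖F1 x‖) := by
    have := exists_continuous_forall_mem_convex_of_local_const (X := U) (E := ℝ)
      (t := fun x => {v | 0 < v ∧ v < e ∧ (x ∈ T → v < ‖F1 x‖)}) ?_ ?_
    · exact this
    · intro x
      by_cases h : x ∈ T
      · have hI : {v : ℝ | 0 < v ∧ v < e ∧ (x ∈ T → v < ‖F1 x‖)} = Ioo 0 (min e ‖F1 x‖) := by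
          ext v
          simp [h]
        simp only [hI]
        exact convex_Ioo _ _
      · have hI : {v : ℝ | 0 < v ∧ v < e ∧ (x ∈ T → v < ‖F1 x‖)} = Ioo 0 e := by
          ext v
          simp [h]
        simp only [hI]
        exact convex_Ioo _ _
    · intro x
      by_cases h : x ∈ T
      · have h0 : 0 < ‖F1 x‖ := norm_pos_iff.2 (hT0 x h)
        have hm : 0 < min e ‖F1 x‖ := lt_min he h0
        refine ⟨min e ‖F1 x‖ / 2, ?_⟩
        have hlt : min e ‖F1 x‖ / 2 < ‖F1 x‖ := by
          have := min_le_right e ‖F1 x‖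
          linarith
        have hc : Continuous fun y => ‖F1 y‖ := by fun_prop
        filter_upwards [hc.continuousAt.eventually (lt_mem_nhds hlt)] with y hy
        refine ⟨by linarith, ?_, fun _ => hy⟩
        have := min_le_left e ‖F1 x‖
        linarith
      · refine ⟨e / 2, ?_⟩
        filter_upwards [hT.isOpen_compl.mem_nhds h] with y hy
        exact ⟨by linarith, by linarith, fun h => absurd h hy⟩
  let K : U → X := fun x => (δ x)⁻¹ • F1 x
  have hK : Continuous K := by
    refine Continuous.smul (Continuous.inv₀ (by fun_prop) fun x => (hδ x).1.ne') (by fun_prop)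
  have : LocallyCompactSpace U := U.isOpen.locallyCompactSpace
  have : SigmaCompactSpace U := sigmaCompactSpace_of_locallyCompact_secondCountable
  obtain ⟨H, hH⟩ := exists_contMDiffMap_forall_mem_convex_of_local_const (n := 1) (𝓘(ℝ, X))
    (M := U) (F := X) (t := fun x => ball (K x) (1/2)) (fun x => convex_ball _ _) (by
      intro x
      refine ⟨K x, ?_⟩
      filter_upwards [(Metric.continuous_iff'.1 hK) x (1/2) (by norm_num)] with y hy
      rwa [mem_ball, dist_comm])
  let H' : X → X := Function.extend Subtype.val H 0
  have hH' : ∀ x : U, H' x = H x := fun x => Subtype.val_injective.extend_apply _ _ _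
  have hdiff : DifferentiableOn ℝ H' S := by
    intro x hx
    have h1 : ContMDiffAt 𝓘(ℝ, X) 𝓘(ℝ, X) 1 (fun y : U => H' y) ⟨x, hSU hx⟩ := by
      have : (fun y : U => H' y) = H := funext hH'
      rw [this]
      exact H.contMDiff _
    rw [contMDiffAt_subtype_iff, contMDiffAt_iff_contDiffAt] at h1
    exact (h1.differentiableAt (by norm_num)).differentiableWithinAt
  have hnull := MeasureTheory.addHaar_image_eq_zero_of_differentiableOn_of_addHaar_eq_zero μ hdiff hS
  obtain ⟨c, hc, hcS⟩ : ∃ c ∈ ball (0 : X) (1/2), c ∉ H' '' S := by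
    by_contra! hcon
    have h1 : μ (ball (0 : X) (1/2)) ≤ 0 := hnull ▸ MeasureTheory.measure_mono hcon
    exact absurd h1 (not_le.2 (measure_ball_pos μ _ (by norm_num)))
  have hclose : ∀ x, ‖δ x • (H x - c) - F1 x‖ < δ x := by
    intro x
    have hp := (hδ x).1
    have h1 : F1 x = δ x • K x := by
      simp only [K]; rw [smul_smul, mul_inv_cancel₀ hp.ne', one_smul]
    rw [h1, ← smul_sub, norm_smul, Real.norm_of_nonneg hp.le]
    have h2 := hH x
    rw [mem_ball, dist_eq_norm] at h2
    rw [mem_ball_zero_iff] at hc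
    have h3 : ‖H x - c - K x‖ < 1 := by
      calc ‖H x - c - K x‖ = ‖(H x - K x) - c‖ := by congr 1; abel
        _ ≤ ‖H x - K x‖ + ‖c‖ := norm_sub_le _ _
        _ < 1 := by linarith
    nlinarith
  refine ⟨⟨fun x => δ x • (H x - c), ?_⟩, ?_, ?_, ?_⟩
  · have := H.contMDiff.continuous
    fun_prop
  · exact fun x => (hclose x).trans (hδ x).2.1
  · intro x hx h0
    have h1 := hclose x
    simp only [ContinuousMap.coe_mk] at h0
    rw [h0, zero_sub, norm_neg] at h1
    exact absurd h1 (not_lt.2 ((hδ x).2.2 hx).le)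
  · intro x hx h0
    simp only [ContinuousMap.coe_mk, smul_eq_zero] at h0
    rcases h0 with h0 | h0
    · exact (hδ x).1.ne' h0
    · exact hcS ⟨x, hx, by rw [hH', sub_eq_zero.1 h0]⟩

theorem zf_balls {X : Type u} [NormedAddCommGroup X] [NormedSpace ℝ X] [FiniteDimensional ℝ X]
    (U : TopologicalSpace.Opens X) (s : Set U) (hs : IsClosed s) (D : Set X) (hD : D.Countable)
    (O : Set X) (hO : IsOpen O) (hsO : ∀ x ∈ s, x.1 ∈ O) (hsD : ∀ x ∈ s, x.1 ∈ closure D) :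
    ∃ (α : Type u) (_ : Countable α) (c : α → X) (r : α → ℝ) (q : α → X),
      (∀ a, 0 < r a ∧ closedBall (c a) (r a) ⊆ O ∧ (∀ d ∈ D, d ∉ sphere (c a) (r a)) ∧
        q a ∈ D ∧ q a ∈ ball (c a) (r a)) ∧
      (∀ x ∈ s, ∃ a, x.1 ∈ ball (c a) (r a)) ∧
      ∀ x ∈ U, ∃ N ∈ 𝓝 x, {a | (closedBall (c a) (r a) ∩ N).Nonempty}.Finite := by
  have : LocallyCompactSpace U := U.isOpen.locallyCompactSpace
  have : SigmaCompactSpace U := sigmaCompactSpace_of_locallyCompact_secondCountable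
  have hB : ∀ x ∈ s, (𝓝 x).HasBasis
      (fun r : ℝ => 0 < r ∧ closedBall x.1 r ⊆ O ∧ (∀ d ∈ D, d ∉ sphere x.1 r))
      (fun r => (Subtype.val : U → X) ⁻¹' ball x.1 r) := by
    intro x hx
    rw [nhds_subtype]
    refine HasBasis.comap _ ?_
    refine nhds_basis_ball.to_hasBasis' ?_ ?_
    · intro ε hε
      obtain ⟨ρ, hρ, hρO⟩ := nhds_basis_closedBall.mem_iff.1 (hO.mem_nhds (hsO x hx))
      obtain ⟨r, hr, hr0, hr1⟩ := ((hD.image (fun d => dist d x.1)).dense_compl ℝ).exists_between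
        (lt_min hε hρ)
      refine ⟨r, ⟨hr0, ?_, ?_⟩, ?_⟩
      · exact (closedBall_subset_closedBall (hr1.le.trans (min_le_right _ _))).trans hρO
      · intro d hd hdr
        exact hr ⟨d, hd, hdr⟩
      · exact ball_subset_ball (hr1.le.trans (min_le_left _ _))
    · exact fun r hr => ball_mem_nhds _ hr.1
  obtain ⟨α, c, r, hp, hcov, hlf⟩ := refinement_of_locallyCompact_sigmaCompact_of_nhds_basis_set hs hB
  have hcount : Countable α := by
    have := hlf.countable_univ (fun a => ⟨c a, mem_ball_self (hp a).2.1⟩)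
    exact Set.countable_univ_iff.1 this
  have hq : ∀ a, ∃ q ∈ D, q ∈ ball (c a).1 (r a) := by
    intro a
    obtain ⟨q, hq, hqD⟩ := mem_closure_iff_nhds.1 (hsD _ (hp a).1) _ (ball_mem_nhds _ (hp a).2.1)
    exact ⟨q, hqD, hq⟩
  choose q hqD hqb using hq
  refine ⟨α, hcount, fun a => (c a).1, r, q, ?_, ?_, ?_⟩
  · exact fun a => ⟨(hp a).2.1, (hp a).2.2.1, (hp a).2.2.2, hqD a, hqb a⟩
  · intro x hx
    obtain ⟨a, ha⟩ := mem_iUnion.1 (hcov hx)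
    exact ⟨a, ha⟩
  · intro x hx
    obtain ⟨N, hN, hfin⟩ := hlf ⟨x, hx⟩
    have h1 : (Subtype.val : U → X) '' N ∈ 𝓝 x :=
      U.isOpen.isOpenMap_subtype_val.image_mem_nhds hN
    refine ⟨interior (Subtype.val '' N), interior_mem_nhds.2 h1, hfin.subset ?_⟩
    rintro a ⟨y, hy, hyN⟩
    rw [← closure_ball _ (hp a).2.1.ne'] at hy
    obtain ⟨z, hzN, hzb⟩ := mem_closure_iff.1 hy _ isOpen_interior hyN
    obtain ⟨w, hw, rfl⟩ := interior_subset hzN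
    exact ⟨w, hzb, hw⟩

/-- **Approximation by zero-free continuous maps** (Izzo).
A continuous `ℝⁿ`-valued map on a subset `E` of `ℝⁿ` that is zero-free on the
interior of `E` is a uniform limit of continuous `ℝⁿ`-valued maps that are
zero-free on all of `E`. -/
theorem zeroFree_approximation (n : ℕ) (hn : 0 < n)
    (E : Set (EuclideanSpace ℝ (Fin n)))
    (f : E → EuclideanSpace ℝ (Fin n)) (hf : Continuous f)
    (hf0 : ∀ x : E, (x : EuclideanSpace ℝ (Fin n)) ∈ interior E → f x ≠ 0)
    (ε : ℝ) (hε : 0 < ε) :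
    ∃ g : E → EuclideanSpace ℝ (Fin n), Continuous g ∧ (∀ x : E, g x ≠ 0) ∧
      ∀ x : E, ‖f x - g x‖ < ε := by
  obtain ⟨e, he, hee⟩ : ∃ e : ℝ, 0 < e ∧ 20 * e = ε := ⟨ε / 20, by positivity, by ring⟩
  obtain ⟨U, hEU, F0, hF0⟩ := zf_ext E f hf e he
  obtain ⟨D, hDE, hDc, hDd⟩ :=
    (TopologicalSpace.IsSeparable.of_separableSpace Eᶜ).exists_countable_dense_subset
  have hn0 : Continuous fun x => ‖F0 x‖ := by fun_prop
  let s : Set U := {x | x.1 ∉ interior E ∧ ‖F0 x‖ ≤ 2 * e}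
  have hs : IsClosed s :=
    (isOpen_interior.isClosed_compl.preimage continuous_subtype_val).inter
      (isClosed_le hn0 continuous_const)
  have hO : IsOpen ((Subtype.val : U → EuclideanSpace ℝ (Fin n)) '' {x : U | ‖F0 x‖ < 3 * e}) :=
    U.isOpen.isOpenMap_subtype_val _ (isOpen_lt hn0 continuous_const)
  obtain ⟨α, hα, c, r, q, hcr, hcov, hlf⟩ := zf_balls U s hs D hDc _ hO
    (fun x hx => ⟨x, by have := hx.2; simp only [mem_ofPred_eq]; linarith, rfl⟩) (by
      intro x hx
      have h1 : x.1 ∈ closure Eᶜ := by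
        rw [closure_compl]; exact hx.1
      exact closure_minimal hDd isClosed_closure h1)
  let T : Set U := {x | ∀ a, x.1 ∉ ball (c a) (r a)}
  have hT : IsClosed T := by
    have : T = ⋂ a, {x : U | x.1 ∈ (ball (c a) (r a))ᶜ} := by
      ext x; simp [T]
    rw [this]
    exact isClosed_iInter fun a =>
      isOpen_ball.isClosed_compl.preimage continuous_subtype_val
  let T' : Set U := T ∩ {x | ‖F0 x‖ ≤ 2 * e}
  have hT' : IsClosed T' := hT.inter (isClosed_le hn0 continuous_const)
  let V' : Set U := {x | x.1 ∈ interior E}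
  have hV' : IsOpen V' := isOpen_interior.preimage continuous_subtype_val
  have hTV : T' ⊆ V' := by
    intro x hx
    by_contra h
    obtain ⟨a, ha⟩ := hcov x ⟨h, hx.2⟩
    exact hx.1 a ha
  let fV : U → EuclideanSpace ℝ (Fin n) := Function.extend (Set.inclusion hEU) f 0
  have hfV : ∀ x : U, ∀ h : x.1 ∈ E, fV x = f ⟨x.1, h⟩ := fun x h =>
    (Set.inclusion_injective hEU).extend_apply f 0 ⟨x.1, h⟩
  have hfVc : ContinuousOn fV V' := by
    rw [continuousOn_iff_continuous_domRestrict]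
    have : V'.domRestrict fV = fun x => f ⟨x.1.1, interior_subset x.2⟩ :=
      funext fun x => hfV x.1 (interior_subset x.2)
    rw [this]
    exact hf.comp (by fun_prop)
  obtain ⟨F1, hF1⟩ := zf_blend F0 fV F0.continuous e he T' V' hT' hV' hTV hfVc (by
    intro x hx
    rw [hfV x (interior_subset hx)]
    exact hF0 x _)
  have hF1T : ∀ x ∈ T, F1 x ≠ 0 := by
    intro x hx h0
    by_cases h : ‖F0 x‖ ≤ 2 * e
    · have hxT : x ∈ T' := ⟨hx, h⟩
      rw [(hF1 x).2 hxT, hfV x (interior_subset (hTV hxT))] at h0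
      exact hf0 ⟨x.1, interior_subset (hTV hxT)⟩ (hTV hxT) h0
    · have := (hF1 x).1
      rw [h0, zero_sub, norm_neg] at this
      linarith
  have hballU : ∀ a, closedBall (c a) (r a) ⊆ U := by
    intro a x hx
    obtain ⟨y, -, rfl⟩ := (hcr a).2.1 hx
    exact y.2
  obtain ⟨F2, hF2, hF2T, hF2S⟩ := zf_perturb MeasureTheory.volume U F1 e he T hT hF1T
    (⋃ a, sphere (c a) (r a)) (iUnion_subset fun a => sphere_subset_closedBall.trans (hballU a)) (by
      rw [MeasureTheory.measure_iUnion_null_iff]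
      exact fun a => MeasureTheory.Measure.addHaar_sphere_of_ne_zero _ _ (hcr a).1.ne')
  let F : EuclideanSpace ℝ (Fin n) → EuclideanSpace ℝ (Fin n) := Function.extend Subtype.val F2 0
  have hFF : ∀ x : U, F x = F2 x := fun x => Subtype.val_injective.extend_apply _ _ _
  let M : Set (EuclideanSpace ℝ (Fin n)) := U \ D
  have hFc : ContinuousOn F M := by
    refine ContinuousOn.mono ?_ (sdiff_subset : M ⊆ U)
    rw [continuousOn_iff_continuous_domRestrict]
    exact F2.continuous.congr fun x => (hFF x).symm
  obtain ⟨i, hi⟩ := exists_injective_nat α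
  let B : ℕ → Set (EuclideanSpace ℝ (Fin n)) := fun k => {x | ∃ a, i a = k ∧ x ∈ closedBall (c a) (r a)}
  have hR : ∀ k, ∃ R : EuclideanSpace ℝ (Fin n) → EuclideanSpace ℝ (Fin n),
      ContinuousOn R M ∧ MapsTo R M M ∧ (∀ x ∉ B k, R x = x) ∧
      ∀ x ∈ B k, x ∈ M → R x ∈ B k ∧ F (R x) ≠ 0 := by
    intro k
    by_cases hk : ∃ a, i a = k
    · obtain ⟨a, rfl⟩ := hk
      have hBa : B (i a) = closedBall (c a) (r a) := by
        ext x
        constructor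
        · rintro ⟨b, hb, hx⟩
          rwa [hi hb] at hx
        · exact fun hx => ⟨a, rfl, hx⟩
      obtain ⟨-, -, hD, hqD, hqb⟩ := hcr a
      obtain ⟨R, hRc, hRi, hRs⟩ := zf_radial (c a) (r a) (q a) hqb
      have hMq : ∀ x ∈ M, x ≠ q a := by
        rintro x hx rfl
        exact hx.2 hqD
      rw [hBa]
      refine ⟨R, hRc.mono hMq, ?_, hRi, ?_⟩
      · intro x hx
        by_cases h : x ∈ closedBall (c a) (r a)
        · have := hRs x h (hMq x hx)
          exact ⟨hballU a (sphere_subset_closedBall this), fun hd => hD _ hd this⟩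
        · rw [hRi x h]; exact hx
      · intro x h hx
        have := hRs x h (hMq x hx)
        have h2 := sphere_subset_closedBall this
        refine ⟨h2, ?_⟩
        rw [hFF ⟨R x, hballU a h2⟩]
        exact hF2S _ (mem_iUnion.2 ⟨a, this⟩)
    · refine ⟨id, continuousOn_id, mapsTo_id _, fun _ _ => rfl, ?_⟩
      rintro x ⟨a, ha, -⟩
      exact absurd ⟨a, ha⟩ hk
  choose R hRc hRM hRi hRB using hR
  obtain ⟨G, hGc, hG0, hGF⟩ := zf_push M F hFc B R hRc hRM hRi hRB (by
    intro x hx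
    obtain ⟨N, hN, hfin⟩ := hlf x hx.1
    obtain ⟨K, hK⟩ := (hfin.image i).bddAbove
    refine ⟨N, hN, K + 1, ?_⟩
    rintro k hk y hy ⟨a, rfl, hya⟩
    have := hK ⟨a, ⟨y, hya, hy⟩, rfl⟩
    omega)
  have hEM : E ⊆ M := fun x hx => ⟨hEU hx, fun hd => hDE hd hx⟩
  have hBs : ∀ x ∈ M, (∃ k, x ∈ B k) → ‖F x‖ < 5 * e := by
    rintro x hx ⟨k, a, -, hxa⟩
    obtain ⟨y, hy, rfl⟩ := (hcr a).2.1 hxa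
    rw [hFF]
    have h1 := hF2 y
    have h2 := (hF1 y).1
    have h3 : ‖F0 y‖ < 3 * e := hy
    have h4 : ‖F2 y‖ ≤ ‖F2 y - F1 y‖ + ‖F1 y - F0 y‖ + ‖F0 y‖ := by
      calc ‖F2 y‖ = ‖(F2 y - F1 y) + (F1 y - F0 y) + F0 y‖ := by congr 1; abel
        _ ≤ _ := norm_add₃_le
    linarith
  refine ⟨fun x => G x, ?_, ?_, ?_⟩
  · exact (hGc.mono hEM).domRestrict
  · intro x
    refine hG0 x (hEM x.2) ?_
    by_cases h : (⟨x.1, hEU x.2⟩ : U) ∈ T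
    · left
      rw [hFF ⟨x.1, hEU x.2⟩]
      exact hF2T _ h
    · right
      simp only [T, mem_ofPred_eq, not_forall, not_not] at h
      obtain ⟨a, ha⟩ := h
      exact ⟨i a, a, rfl, ball_subset_closedBall ha⟩
  · intro x
    have h1 := hF2 ⟨x.1, hEU x.2⟩
    have h2 := (hF1 ⟨x.1, hEU x.2⟩).1
    have h3 := hF0 ⟨x.1, hEU x.2⟩ x.2
    rw [← hFF] at h1
    have h4 : ‖F x - f x‖ < 3 * e := by
      calc ‖F x - f x‖ = ‖(F x - F1 ⟨x.1, hEU x.2⟩) + (F1 ⟨x.1, hEU x.2⟩ - F0 ⟨x.1, hEU x.2⟩)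
            + (F0 ⟨x.1, hEU x.2⟩ - f x)‖ := by congr 1; abel
        _ ≤ _ := norm_add₃_le
        _ < 3 * e := by linarith
    rw [norm_sub_rev]
    change ‖G x - f x‖ < ε
    rcases hGF x (hEM x.2) with h | ⟨hx, y, hy, hyB, h⟩
    · rw [h]; linarith
    · have h5 := hBs x (hEM x.2) hx
      have h6 := hBs y hy hyB
      rw [h]
      calc ‖F y - f x‖ = ‖F y + (- F x) + (F x - f x)‖ := by congr 1; abel
        _ ≤ ‖F y‖ + ‖- F x‖ + ‖F x - f x‖ := norm_add₃_le
        _ < ε := by rw [norm_neg]; linarith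
end

section
/- Let n ≥ 1, let E ⊆ ℝⁿ, let f : E → ℝⁿ be continuous with f(x) ≠ 0 for every x in the interior of E, and let ε > 0. Then there exist a natural number N, a simplicial complex K in ℝᴺ (a locally finite geometric simplicial complex, closed under faces, with any two simplices intersecting in a common face) all of whose simplices have dimension at most n, a continuous map h : E → |K| into the polytope |K| (the union of the simplices of K), and a continuous map g : |K| → ℝⁿ such that g(y) ≠ 0 for every point y lying in an n-dimensional simplex of K, and sup_{x ∈ E} |f(x) − g(h(x))| < ε. -/
open Geometry


/-- Faces of the Kuhn (Freudenthal) triangulation. -/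
def KFace {n : ℕ} (s : Finset (EuclideanSpace ℝ (Fin n))) : Prop :=
  (∀ v ∈ s, ∀ i, ∃ m : ℤ, v i = m) ∧
  ∀ v ∈ s, ∀ w ∈ s, (∀ i, v i ≤ w i ∧ w i ≤ v i + 1) ∨ (∀ i, w i ≤ v i ∧ v i ≤ w i + 1)

/-- Sum of coordinates. -/
noncomputable def sg {n : ℕ} (v : EuclideanSpace ℝ (Fin n)) : ℝ := ∑ i, v i

theorem sg_lt_le {n : ℕ} {s : Finset (EuclideanSpace ℝ (Fin n))} (hs : KFace s)
    {u v : EuclideanSpace ℝ (Fin n)} (hu : u ∈ s) (hv : v ∈ s) (h : sg u < sg v) (i : Fin n) :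
    u i ≤ v i ∧ v i ≤ u i + 1 := by
  rcases hs.2 u hu v hv with h1 | h1
  · exact h1 i
  · exact absurd h (not_lt.2 (Finset.sum_le_sum fun i _ => (h1 i).1))

theorem sg_ge_le {n : ℕ} {s : Finset (EuclideanSpace ℝ (Fin n))} (hs : KFace s)
    {u v : EuclideanSpace ℝ (Fin n)} (hu : u ∈ s) (hv : v ∈ s) (h : sg v ≤ sg u) (i : Fin n) :
    v i ≤ u i ∧ u i ≤ v i + 1 := by
  rcases hs.2 u hu v hv with h1 | h1
  · have h2 : sg u ≤ sg v := Finset.sum_le_sum fun i _ => (h1 i).1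
    have h3 := (Finset.sum_eq_sum_iff_of_le (fun i _ => (h1 i).1)).1 (le_antisymm h2 h) i
      (Finset.mem_univ i)
    rw [h3]; constructor <;> linarith
  · exact h1 i

theorem sg_inj {n : ℕ} {s : Finset (EuclideanSpace ℝ (Fin n))} (hs : KFace s)
    {u v : EuclideanSpace ℝ (Fin n)} (hu : u ∈ s) (hv : v ∈ s) (h : sg v = sg u) : u = v := by
  ext i
  exact le_antisymm (sg_ge_le hs hv hu h.ge i).1 (sg_ge_le hs hu hv h.le i).1

theorem kuhn_bracket {n : ℕ} {s : Finset (EuclideanSpace ℝ (Fin n))} (hs : KFace s)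
    {w : EuclideanSpace ℝ (Fin n) → ℝ} (hw : ∀ u ∈ s, 0 ≤ w u) (hw1 : ∑ u ∈ s, w u = 1)
    {v : EuclideanSpace ℝ (Fin n)} (hv : v ∈ s) {τ : ℝ}
    (h1 : ∑ u ∈ s with sg u < sg v, w u ≤ τ) (h2 : τ < ∑ u ∈ s with sg u < sg v, w u + w v)
    (i : Fin n) :
    v i ≤ (∑ u ∈ s, w u • u) i + τ ∧ (∑ u ∈ s, w u • u) i + τ < v i + 1 := by
  classical
  have hy : (∑ u ∈ s, w u • u) i - v i = ∑ u ∈ s, w u * (u i - v i) := by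
    simp only [mul_sub, Finset.sum_sub_distrib, ← Finset.sum_mul, hw1]
    simp
  have hc : ∑ u ∈ s with sg u < sg v, w u = ∑ u ∈ s, w u * (if sg u < sg v then 1 else 0) := by
    simp [Finset.sum_filter]
  have he : w v = ∑ u ∈ s, w u * (if u = v then 1 else 0) := by
    simp [hv]
  have hlow : - ∑ u ∈ s, w u * (if sg u < sg v then (1:ℝ) else 0) ≤ ∑ u ∈ s, w u * (u i - v i) := by
    rw [← Finset.sum_neg_distrib]
    refine Finset.sum_le_sum fun u hu => ?_
    rw [← mul_neg]
    refine mul_le_mul_of_nonneg_left ?_ (hw u hu)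
    split_ifs with h
    · have := sg_lt_le hs hu hv h i
      linarith
    · have := sg_ge_le hs hu hv (not_lt.1 h) i
      linarith
  have hup : ∑ u ∈ s, w u * (u i - v i) ≤ ∑ u ∈ s, w u -
      ∑ u ∈ s, w u * (if sg u < sg v then (1:ℝ) else 0) - ∑ u ∈ s, w u * (if u = v then (1:ℝ) else 0) := by
    rw [← Finset.sum_sub_distrib, ← Finset.sum_sub_distrib]
    refine Finset.sum_le_sum fun u hu => ?_
    have h0 := hw u hu
    have : u i - v i ≤ 1 - (if sg u < sg v then (1:ℝ) else 0) - (if u = v then (1:ℝ) else 0) := by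
      split_ifs with h h' h'
      · subst h'; simp at h
      · have := sg_lt_le hs hu hv h i
        linarith
      · subst h'; simp
      · have := sg_ge_le hs hu hv (not_lt.1 h) i
        linarith
    nlinarith
  rw [hw1] at hup
  constructor <;> linarith

theorem kuhn_exists {n : ℕ} {s : Finset (EuclideanSpace ℝ (Fin n))}
    {w : EuclideanSpace ℝ (Fin n) → ℝ} (hs : KFace s)
    (hw1 : ∑ u ∈ s, w u = 1) {τ : ℝ} (h0 : 0 ≤ τ) (h1 : τ < 1) :
    ∃ v ∈ s, ∑ u ∈ s with sg u < sg v, w u ≤ τ ∧ τ < ∑ u ∈ s with sg u < sg v, w u + w v := by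
  classical
  have hne : s.Nonempty := by
    by_contra h
    rw [Finset.not_nonempty_iff_eq_empty] at h
    simp [h] at hw1
  have hne' : (s.filter fun v => ∑ u ∈ s with sg u < sg v, w u ≤ τ).Nonempty := by
    obtain ⟨v, hv, hmin⟩ := Finset.exists_min_image s sg hne
    refine ⟨v, Finset.mem_filter.2 ⟨hv, ?_⟩⟩
    rw [Finset.filter_false_of_mem (fun u hu => not_lt.2 (hmin u hu))]
    simpa using h0
  obtain ⟨v, hv, hmax⟩ := Finset.exists_max_image _ sg hne'
  rw [Finset.mem_filter] at hv
  refine ⟨v, hv.1, hv.2, ?_⟩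
  by_contra hcon
  rw [not_lt] at hcon
  have hle : ∑ u ∈ s with sg u ≤ sg v, w u = ∑ u ∈ s with sg u < sg v, w u + w v := by
    rw [add_comm, ← Finset.sum_insert (a := v) (by simp)]
    congr 1
    ext u
    simp only [Finset.mem_filter, Finset.mem_insert]
    constructor
    · rintro ⟨hu, h⟩
      rcases h.lt_or_eq with h | h
      · exact Or.inr ⟨hu, h⟩
      · exact Or.inl (sg_inj hs hu hv.1 h.symm)
    · rintro (rfl | ⟨hu, h⟩)
      · exact ⟨hv.1, le_rfl⟩
      · exact ⟨hu, h.le⟩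
  rw [← hle] at hcon
  have hne2 : (s.filter fun u => sg v < sg u).Nonempty := by
    by_contra h
    rw [Finset.not_nonempty_iff_eq_empty, Finset.filter_eq_empty_iff] at h
    rw [Finset.filter_true_of_mem (fun u hu => not_lt.1 (h hu)), hw1] at hcon
    linarith
  obtain ⟨u, hu, hmin⟩ := Finset.exists_min_image _ sg hne2
  rw [Finset.mem_filter] at hu
  have : sg u ≤ sg v := by
    apply hmax u
    refine Finset.mem_filter.2 ⟨hu.1, ?_⟩
    have hfe : (s.filter fun x => sg x < sg u) = s.filter fun x => sg x ≤ sg v := by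
      ext x
      simp only [Finset.mem_filter, and_congr_right_iff]
      intro hx
      constructor
      · intro h
        by_contra h2
        exact absurd (hmin x (Finset.mem_filter.2 ⟨hx, not_le.1 h2⟩)) (not_le.2 h)
      · intro h
        exact h.trans_lt hu.2
    rw [hfe]; exact hcon
  linarith [hu.2]

theorem kuhn_support {n : ℕ} {s t : Finset (EuclideanSpace ℝ (Fin n))} (hs : KFace s) (ht : KFace t)
    {w w' : EuclideanSpace ℝ (Fin n) → ℝ} (hw : ∀ u ∈ s, 0 ≤ w u) (hw1 : ∑ u ∈ s, w u = 1)
    (hw' : ∀ u ∈ t, 0 ≤ w' u) (hw1' : ∑ u ∈ t, w' u = 1)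
    (heq : ∑ u ∈ s, w u • u = ∑ u ∈ t, w' u • u)
    {v : EuclideanSpace ℝ (Fin n)} (hv : v ∈ s) (hpos : 0 < w v) : v ∈ t ∧ 0 < w' v := by
  classical
  set τ := ∑ u ∈ s with sg u < sg v, w u with hτ
  have h0 : 0 ≤ τ := Finset.sum_nonneg fun u hu => hw u (Finset.mem_filter.1 hu).1
  have h1 : τ < 1 := by
    have : τ + w v ≤ 1 := by
      rw [← hw1, add_comm, hτ, ← Finset.sum_insert (a := v) (by simp)]
      refine Finset.sum_le_sum_of_subset_of_nonneg ?_ (fun u hu _ => hw u hu)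
      intro u hu
      rcases Finset.mem_insert.1 hu with rfl | h
      · exact hv
      · exact (Finset.mem_filter.1 h).1
    linarith
  obtain ⟨v', hv', ha, hb⟩ := kuhn_exists ht hw1' h0 h1
  have hvv : v = v' := by
    ext i
    have e1 := kuhn_bracket hs hw hw1 hv (τ := τ) le_rfl (by linarith) i
    have e2 := kuhn_bracket ht hw' hw1' hv' ha hb i
    rw [← heq] at e2
    obtain ⟨m, hm⟩ := hs.1 v hv i
    obtain ⟨m', hm'⟩ := ht.1 v' hv' i
    rw [hm] at e1 ⊢
    rw [hm'] at e2 ⊢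
    have a1 : (m : ℝ) < m' + 1 := by linarith
    have a2 : (m' : ℝ) < m + 1 := by linarith
    norm_cast at a1 a2 ⊢
    omega
  subst hvv
  exact ⟨hv', by linarith⟩

theorem kuhn_inter {n : ℕ} {s t : Finset (EuclideanSpace ℝ (Fin n))} (hs : KFace s) (ht : KFace t) :
    convexHull ℝ (s : Set (EuclideanSpace ℝ (Fin n))) ∩ convexHull ℝ (t : Set _) ⊆
      convexHull ℝ ((s : Set _) ∩ t) := by
  classical
  rintro y ⟨h1, h2⟩
  rw [Finset.mem_convexHull'] at h1 h2
  obtain ⟨w, hw, hw1, hy⟩ := h1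
  obtain ⟨w', hw', hw1', hy'⟩ := h2
  have key : ∀ v ∈ s, v ∉ t → w v = 0 := by
    intro v hv hvt
    by_contra h
    exact hvt (kuhn_support hs ht hw hw1 hw' hw1' (hy.trans hy'.symm) hv
      (lt_of_le_of_ne (hw v hv) (Ne.symm h))).1
  rw [← Finset.coe_inter, Finset.mem_convexHull']
  refine ⟨w, fun v hv => hw v (Finset.mem_inter.1 hv).1, ?_, ?_⟩
  · rw [← hw1]
    refine Finset.sum_subset Finset.inter_subset_left fun v hv hv' => key v hv ?_
    intro h; exact hv' (Finset.mem_inter.2 ⟨hv, h⟩)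
  · rw [← hy]
    refine Finset.sum_subset Finset.inter_subset_left fun v hv hv' => ?_
    rw [key v hv (fun h => hv' (Finset.mem_inter.2 ⟨hv, h⟩)), zero_smul]

theorem kuhn_indep {n : ℕ} {s : Finset (EuclideanSpace ℝ (Fin n))} (hs : KFace s) :
    AffineIndependent ℝ ((↑) : s → EuclideanSpace ℝ (Fin n)) := by
  classical
  rw [affineIndependent_iff]
  intro S w hw0 hwv
  -- extend to all of s
  by_contra hcon
  push Not at hcon
  obtain ⟨e, he, hne⟩ := hcon
  let W : EuclideanSpace ℝ (Fin n) → ℝ := fun v => if h : v ∈ s then (if (⟨v, h⟩ : s) ∈ S then w ⟨v, h⟩ else 0) else 0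
  have hW : ∀ v : s, W v = if v ∈ S then w v else 0 := by
    intro v; simp [W]
  have hW0 : ∑ v ∈ s, W v = 0 := by
    rw [← Finset.sum_coe_sort s]
    simp only [hW]
    rw [Finset.sum_ite_mem, Finset.univ_inter]; exact hw0
  have hWv : ∑ v ∈ s, W v • v = 0 := by
    rw [← Finset.sum_coe_sort s]
    simp only [hW, ite_smul, zero_smul]
    rw [Finset.sum_ite_mem, Finset.univ_inter]; exact hwv
  have hWe : W e ≠ 0 := by rw [hW, if_pos he]; exact hne
  obtain ⟨u, hu, hmin⟩ := Finset.exists_min_image s W ⟨e, e.2⟩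
  have hneg : W u < 0 := by
    by_contra h
    rw [not_lt] at h
    have := (Finset.sum_eq_zero_iff_of_nonneg (fun v hv => h.trans (hmin v hv))).1 hW0 e e.2
    exact hWe this
  have hcard : (0 : ℝ) < s.card := by
    exact_mod_cast Finset.card_pos.2 (⟨e.1, e.2⟩ : s.Nonempty)
  have h1 : ∑ v ∈ s, (s.card : ℝ)⁻¹ = 1 := by
    simp; field_simp
  have hm : (0:ℝ) < (s.card : ℝ)⁻¹ := by positivity
  set m := (s.card : ℝ)⁻¹ 
  have := kuhn_support hs hs (w := fun _ => m) (w' := fun v => m + (-m / W u) * W v) (v := u)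
    (fun _ _ => hm.le) h1 (fun v hv => ?_) ?_ ?_ hu hm
  · have h2 := this.2
    rw [div_mul_cancel₀ _ hneg.ne] at h2
    linarith
  · have := hmin v hv
    have h3 : W v / W u ≤ 1 := by
      rw [div_le_one_of_neg hneg]; exact this
    have : m + -m / W u * W v = m * (1 - W v / W u) := by field_simp; ring
    rw [this]
    exact mul_nonneg hm.le (by linarith)
  · rw [Finset.sum_add_distrib, ← Finset.mul_sum, hW0, h1]; simp
  · simp only [add_smul, mul_smul, Finset.sum_add_distrib, ← Finset.smul_sum, hWv]
    simp

theorem kuhn_card {n : ℕ} {s : Finset (EuclideanSpace ℝ (Fin n))} (hs : KFace s) :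
    s.card ≤ n + 1 := by
  classical
  rcases s.eq_empty_or_nonempty with rfl | hne
  · simp
  obtain ⟨v, hv, hmin⟩ := Finset.exists_min_image s sg hne
  have hcov : ∀ u ∈ s, ∃ m : ℤ, sg u = m := by
    intro u hu
    choose m hm using hs.1 u hu
    exact ⟨∑ i, m i, by simp [sg, hm]⟩
  have hf : ∀ u ∈ s, (⌊sg u⌋ : ℝ) = sg u := by
    intro u hu
    obtain ⟨m, hm⟩ := hcov u hu
    rw [hm]; simp
  have : s.card ≤ (Finset.Icc ⌊sg v⌋ (⌊sg v⌋ + n)).card := by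
    refine Finset.card_le_card_of_injOn (fun u => ⌊sg u⌋) ?_ ?_
    · intro u hu
      have hu : u ∈ s := hu
      have h1 := hmin u hu
      have h2 : sg u ≤ sg v + n := by
        have : ∑ i, u i ≤ ∑ i, (v i + 1) :=
          Finset.sum_le_sum fun i _ => (sg_ge_le hs hu hv h1 i).2
        simpa [Finset.sum_add_distrib, sg] using this
      rw [← hf u hu, ← hf v hv] at h1 h2
      simp only [Finset.coe_Icc, Set.mem_Icc]
      constructor
      · exact_mod_cast h1
      · exact_mod_cast h2
    · intro a ha b hb hab
      have ha : a ∈ s := ha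
      have hb : b ∈ s := hb
      refine sg_inj hs ha hb ?_
      rw [← hf a ha, ← hf b hb]
      simp only at hab
      rw [hab]
  refine this.trans ?_
  rw [Int.card_Icc]
  omega

theorem kuhn_cover_aux {n : ℕ} (b : Fin n → ℤ) : ∀ (k : ℕ) (y : EuclideanSpace ℝ (Fin n)),
    (∀ i, (b i : ℝ) ≤ y i ∧ y i ≤ b i + 1) → (Finset.univ.filter fun i => (b i : ℝ) < y i).card = k →
    ∃ s : Finset (EuclideanSpace ℝ (Fin n)), KFace s ∧ y ∈ convexHull ℝ (s : Set _) ∧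
      ∀ v ∈ s, ∀ i, (v i = b i) ∨ (v i = b i + 1 ∧ (b i : ℝ) < y i) := by
  classical
  intro k
  induction k using Nat.strong_induction_on with
  | _ k ih =>
  intro y hy hk
  set I := Finset.univ.filter fun i => (b i : ℝ) < y i with hI
  -- top vertex
  let p : EuclideanSpace ℝ (Fin n) := WithLp.toLp 2 fun i => if (b i : ℝ) < y i then (b i : ℝ) + 1 else b i
  have hp : ∀ i, p i = if (b i : ℝ) < y i then (b i : ℝ) + 1 else b i := fun i => rfl
  have hpint : ∀ i, ∃ m : ℤ, p i = m := by
    intro i; rw [hp]; split_ifs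
    · exact ⟨b i + 1, by push_cast; rfl⟩
    · exact ⟨b i, rfl⟩
  have hpface : KFace {p} := by
    refine ⟨by simpa using hpint, ?_⟩
    simp only [Finset.mem_singleton, forall_eq]
    left; intro i; constructor <;> linarith
  have hpv : ∀ i, (p i = b i) ∨ (p i = b i + 1 ∧ (b i : ℝ) < y i) := by
    intro i; rw [hp]; split_ifs with h
    · right; exact ⟨rfl, h⟩
    · left; rfl
  by_cases hall : y = p
  · refine ⟨{p}, hpface, by simp [hall], ?_⟩
    intro v hv; rw [Finset.mem_singleton] at hv; subst hv; exact hpv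
  have hIne : I.Nonempty := by
    by_contra h
    rw [Finset.not_nonempty_iff_eq_empty, Finset.filter_eq_empty_iff] at h
    apply hall
    ext i
    have := h (Finset.mem_univ i)
    rw [hp, if_neg this]
    exact le_antisymm (not_lt.1 this) (hy i).1
  obtain ⟨j, hj, hjmin⟩ := Finset.exists_min_image I (fun i => y i - b i) hIne
  set m := y j - b j with hm
  have hm0 : 0 < m := by
    have := (Finset.mem_filter.1 hj).2
    linarith
  have hm1 : m < 1 := by
    by_contra h
    apply hall
    ext i
    rw [hp]
    split_ifs with hi
    · have := hjmin i (Finset.mem_filter.2 ⟨Finset.mem_univ i, hi⟩)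
      have := (hy i).2
      linarith
    · exact le_antisymm (not_lt.1 hi) (hy i).1
  let y' : EuclideanSpace ℝ (Fin n) := WithLp.toLp 2 fun i =>
    if (b i : ℝ) < y i then (b i : ℝ) + (y i - b i - m) / (1 - m) else b i
  have hy' : ∀ i, y' i = if (b i : ℝ) < y i then (b i : ℝ) + (y i - b i - m) / (1 - m) else b i :=
    fun i => rfl
  have h1m : 0 < 1 - m := by linarith
  have hlt : ∀ i, (b i : ℝ) < y' i → (b i : ℝ) < y i := by
    intro i h; rw [hy'] at h
    by_contra h2
    rw [if_neg h2] at h; exact lt_irrefl _ h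
  obtain ⟨s, hs, hys, hsv⟩ := ih (Finset.univ.filter fun i => (b i : ℝ) < y' i).card (by
      rw [← hk]
      refine Finset.card_lt_card ?_
      rw [Finset.ssubset_iff_of_subset]
      · refine ⟨j, hj, ?_⟩
        simp only [Finset.mem_filter, Finset.mem_univ, true_and, not_lt]
        rw [hy', if_pos (Finset.mem_filter.1 hj).2, ← hm]
        simp
      · intro i hi
        rw [Finset.mem_filter] at hi ⊢
        exact ⟨hi.1, hlt i hi.2⟩) y' (by
      intro i
      rw [hy']
      split_ifs with hi
      · have h1 := hjmin i (Finset.mem_filter.2 ⟨Finset.mem_univ i, hi⟩)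
        have h2 := (hy i).2
        have : 0 ≤ (y i - b i - m) / (1 - m) := div_nonneg (by linarith) h1m.le
        have : (y i - b i - m) / (1 - m) ≤ 1 := (div_le_one h1m).2 (by linarith)
        constructor <;> linarith
      · constructor <;> linarith) rfl
  have hsv' : ∀ v ∈ s, ∀ i, (v i = b i) ∨ (v i = b i + 1 ∧ (b i : ℝ) < y i) := by
    intro v hv i
    rcases hsv v hv i with h | h
    · exact Or.inl h
    · exact Or.inr ⟨h.1, hlt i h.2⟩
  have hcmp : ∀ v ∈ s, ∀ i, v i ≤ p i ∧ p i ≤ v i + 1 := by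
    intro v hv i
    rw [hp]
    rcases hsv' v hv i with h | h
    · rw [h]; split_ifs <;> constructor <;> linarith
    · rw [if_pos h.2, h.1]; constructor <;> linarith
  refine ⟨insert p s, ⟨?_, ?_⟩, ?_, ?_⟩
  · intro v hv
    rcases Finset.mem_insert.1 hv with rfl | hv
    · exact hpint
    · exact hs.1 v hv
  · intro v hv w hw
    rcases Finset.mem_insert.1 hv with rfl | hv <;> rcases Finset.mem_insert.1 hw with rfl | hw
    · left; intro i; constructor <;> linarith
    · right; exact hcmp w hw
    · left; exact hcmp v hv
    · exact hs.2 v hv w hw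
  · have hpm : p ∈ convexHull ℝ ((insert p s : Finset _) : Set (EuclideanSpace ℝ (Fin n))) :=
      subset_convexHull _ _ (by simp)
    have hym : y' ∈ convexHull ℝ ((insert p s : Finset _) : Set (EuclideanSpace ℝ (Fin n))) :=
      convexHull_mono (by simp) hys
    have := convex_convexHull ℝ ((insert p s : Finset _) : Set (EuclideanSpace ℝ (Fin n))) hpm hym
      hm0.le h1m.le (by ring)
    convert this using 1
    ext i
    simp only [PiLp.add_apply, PiLp.smul_apply, smul_eq_mul]
    rw [hp, hy']
    split_ifs with hi
    · field_simp; ring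
    · have := le_antisymm (not_lt.1 hi) (hy i).1
      rw [this]; ring
  · intro v hv
    rcases Finset.mem_insert.1 hv with rfl | hv
    · exact hpv
    · exact hsv' v hv

theorem kuhn_cover {n : ℕ} (y : EuclideanSpace ℝ (Fin n)) :
    ∃ s : Finset (EuclideanSpace ℝ (Fin n)), KFace s ∧ y ∈ convexHull ℝ (s : Set _) ∧
      ∀ v ∈ s, ∀ i, |y i - v i| ≤ 1 := by
  obtain ⟨s, hs, hy, h⟩ := kuhn_cover_aux (fun i => ⌊y i⌋) _ y
    (fun i => ⟨Int.floor_le _, (Int.lt_floor_add_one _).le⟩) rfl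
  refine ⟨s, hs, hy, fun v hv i => ?_⟩
  have h1 := Int.floor_le (y i)
  have h2 := Int.lt_floor_add_one (y i)
  rw [abs_le]
  rcases h v hv i with h | h
  · rw [h]; constructor <;> linarith
  · rw [h.1]; constructor <;> linarith

/-- The Kuhn triangulation with the open star of the origin removed. -/
def kuhnK (n : ℕ) : SimplicialComplex ℝ (EuclideanSpace ℝ (Fin n)) where
  faces := {s | s.Nonempty ∧ KFace s ∧ (0 : EuclideanSpace ℝ (Fin n)) ∉ s}
  isRelLowerSet_faces := by
    rintro s ⟨h1, h2, h3⟩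
    refine ⟨h1, fun t hts ht => ⟨ht, ⟨fun v hv => h2.1 v (hts hv),
      fun v hv w hw => h2.2 v (hts hv) w (hts hw)⟩, fun h => h3 (hts h)⟩⟩
  indep := fun hs => kuhn_indep hs.2.1
  inter_subset_convexHull := fun hs ht => kuhn_inter hs.2.1 ht.2.1

theorem kuhnK_zero {n : ℕ} {y : EuclideanSpace ℝ (Fin n)} (hy : y ∈ (kuhnK n).space) : y ≠ 0 := by
  rintro rfl
  obtain ⟨s, hs, h⟩ := SimplicialComplex.mem_space_iff.1 hy
  have h0 : KFace ({0} : Finset (EuclideanSpace ℝ (Fin n))) := by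
    refine ⟨?_, ?_⟩
    · simp only [Finset.mem_singleton, forall_eq]
      intro i; exact ⟨0, by simp⟩
    · simp
  have := kuhn_inter hs.2.1 h0 ⟨h, by simp⟩
  have he : (s : Set (EuclideanSpace ℝ (Fin n))) ∩ (({0} : Finset (EuclideanSpace ℝ (Fin n))) : Set _) = ∅ := by
    ext x
    simp only [Finset.coe_singleton, Set.mem_inter_iff, Set.mem_singleton_iff, Set.mem_empty_iff_false,
      iff_false, not_and]
    rintro hx rfl
    exact hs.2.2 hx
  rw [he] at this
  simp at this

theorem kuhnK_mem {n : ℕ} {y : EuclideanSpace ℝ (Fin n)} (hy : (n : ℝ) < ‖y‖) :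
    y ∈ (kuhnK n).space := by
  obtain ⟨s, hs, hys, h⟩ := kuhn_cover y
  refine SimplicialComplex.mem_space_iff.2 ⟨s, ⟨?_, hs, ?_⟩, hys⟩
  · have := (convexHull_nonempty_iff (𝕜 := ℝ)).1 ⟨y, hys⟩
    exact_mod_cast this
  · intro h0
    have h1 : ∀ i, |y i| ≤ 1 := fun i => by simpa using h 0 h0 i
    have : ‖y‖ ≤ n := by
      have h2 : ‖y‖ ^ 2 ≤ (n : ℝ) := by
        rw [EuclideanSpace.norm_sq_eq]
        calc ∑ i, ‖y i‖ ^ 2 ≤ ∑ i : Fin n, (1 : ℝ) := by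
              refine Finset.sum_le_sum fun i _ => ?_
              rw [Real.norm_eq_abs]
              exact pow_le_one₀ (abs_nonneg _) (h1 i)
          _ = n := by simp
      have h3 : (n : ℝ) ≤ n ^ 2 := by
        exact_mod_cast Nat.le_self_pow (by norm_num) n
      exact abs_le_of_sq_le_sq' (h2.trans h3) (Nat.cast_nonneg n) |>.2
    linarith

theorem kuhnK_locallyFinite (n : ℕ) : LocallyFinite fun s : (kuhnK n).faces =>
    convexHull ℝ ((s : Finset (EuclideanSpace ℝ (Fin n))) : Set (EuclideanSpace ℝ (Fin n))) := by
  classical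
  intro x
  refine ⟨Metric.ball x 1, Metric.ball_mem_nhds x one_pos, ?_⟩
  -- finite set of admissible vertices
  let A : Set (EuclideanSpace ℝ (Fin n)) :=
    {v | (∀ i, ∃ m : ℤ, v i = m) ∧ ∀ i, |v i - x i| ≤ 2}
  have hA : A.Finite := by
    have hfin : (Set.pi Set.univ fun i : Fin n => Set.Icc ⌊x i - 2⌋ ⌈x i + 2⌉).Finite :=
      Set.Finite.pi fun i => Set.finite_Icc _ _
    refine (hfin.image fun (m : Fin n → ℤ) =>
      (WithLp.toLp 2 fun i => (m i : ℝ) : EuclideanSpace ℝ (Fin n))).subset ?_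
    rintro v ⟨h1, h2⟩
    choose m hm using h1
    refine ⟨m, ?_, ?_⟩
    · intro i _
      have := abs_le.1 (h2 i)
      rw [hm] at this
      constructor
      · have : (⌊x i - 2⌋ : ℝ) ≤ m i := (Int.floor_le _).trans (by linarith)
        exact_mod_cast this
      · have : (m i : ℝ) ≤ ⌈x i + 2⌉ := le_trans (by linarith) (Int.le_ceil _)
        exact_mod_cast this
    · ext i; exact (hm i).symm
  have hB : {s : Finset (EuclideanSpace ℝ (Fin n)) | (s : Set _) ⊆ A}.Finite  := by
    refine Set.Finite.of_finite_image (f := fun s : Finset (EuclideanSpace ℝ (Fin n)) => (s : Set _))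
      (hA.finite_subsets.subset ?_) Finset.coe_injective.injOn
    rintro _ ⟨s, hs, rfl⟩
    exact hs
  refine Set.Finite.of_finite_image (f := Subtype.val) (hB.subset ?_) Subtype.val_injective.injOn
  rintro _ ⟨⟨s, hs⟩, ⟨y, hy, hyx⟩, rfl⟩
  intro v hv
  have hv : v ∈ s := hv
  refine ⟨hs.2.1.1 v hv, fun i => ?_⟩
  have h1 : |y i - v i| ≤ 1 := by
    have hc : Convex ℝ {z : EuclideanSpace ℝ (Fin n) | |z i - v i| ≤ 1} := by
      have : {z : EuclideanSpace ℝ (Fin n) | |z i - v i| ≤ 1} =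
        (EuclideanSpace.proj i : EuclideanSpace ℝ (Fin n) →L[ℝ] ℝ) ⁻¹' (Set.Icc (v i - 1) (v i + 1)) := by
        ext z
        change |z i - v i| ≤ 1 ↔ v i - 1 ≤ z i ∧ z i ≤ v i + 1
        rw [abs_le]
        constructor <;> rintro ⟨_, _⟩ <;> constructor <;> linarith
      rw [this]
      exact (convex_Icc _ _).linear_preimage (EuclideanSpace.proj i : EuclideanSpace ℝ (Fin n) →L[ℝ] ℝ).toLinearMap
    refine convexHull_min ?_ hc hy
    intro u hu
    change |u i - v i| ≤ 1
    rw [abs_le]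
    rcases hs.2.1.2 u hu v hv with h | h <;> have := h i <;> constructor <;> linarith
  have h2 : |y i - x i| ≤ 1 := by
    have := PiLp.norm_apply_le (y - x) i
    rw [Metric.mem_ball, dist_eq_norm] at hyx
    simp only [PiLp.sub_apply, Real.norm_eq_abs] at this
    linarith
  rw [abs_le] at *
  constructor <;> linarith


section topo

variable {V : Type*} [NormedAddCommGroup V] [InnerProductSpace ℝ V]

open scoped Manifold ContDiff Topology in
theorem smooth_approx [FiniteDimensional ℝ V] (Y : Set V) (Φ : V → V) (hΦ : ContinuousOn Φ Y) {δ : ℝ} (hδ : 0 < δ) :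
    ∃ W : Set V, IsOpen W ∧ Y ⊆ W ∧ ∃ Ψ : V → V, DifferentiableOn ℝ Ψ W ∧
      ∀ x ∈ Y, ‖Ψ x - Φ x‖ < δ := by
  classical
  have h1 : ∀ y : Y, ∃ U : Set V, IsOpen U ∧ (y : V) ∈ U ∧ ∀ x ∈ U, x ∈ Y → ‖Φ y - Φ x‖ < δ := by
    intro y
    have := (hΦ y y.2).eventually (Metric.ball_mem_nhds (Φ y) hδ)
    obtain ⟨U, hU, hyU, h⟩ := mem_nhdsWithin.1 this
    refine ⟨U, hU, hyU, fun x hx hxY => ?_⟩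
    have := h ⟨hx, hxY⟩
    change Φ x ∈ Metric.ball (Φ y) δ at this
    rwa [mem_ball_iff_norm'] at this
  choose U hU hyU hUy using h1
  let W : TopologicalSpace.Opens V := ⟨⋃ y, U y, isOpen_iUnion hU⟩
  have : ProperSpace V := FiniteDimensional.proper_real V
  have : LocallyCompactSpace W := W.2.locallyCompactSpace
  have : SigmaCompactSpace W := inferInstance
  obtain ⟨g, hg⟩ := exists_contMDiffMap_forall_mem_convex_of_local_const (M := W) (F := V)
    (n := (⊤ : ℕ∞)) 𝓘(ℝ, V) (t := fun x => {v : V | (x : V) ∈ Y → ‖v - Φ x‖ < δ}) (fun x => by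
      by_cases hx : (x : V) ∈ Y
      · have : {v : V | (x : V) ∈ Y → ‖v - Φ x‖ < δ} = Metric.ball (Φ x) δ := by
          ext v; simp [hx, dist_eq_norm]
        rw [this]; exact convex_ball _ _
      · have : {v : V | (x : V) ∈ Y → ‖v - Φ x‖ < δ} = Set.univ := by
          ext v; simp [hx]
        rw [this]; exact convex_univ) (fun x => by
      obtain ⟨y, hy⟩ := Set.mem_iUnion.1 x.2
      refine ⟨Φ y, ?_⟩
      have : ∀ᶠ x' : W in 𝓝 x, (x' : V) ∈ U y :=
        continuous_subtype_val.continuousAt.eventually ((hU y).mem_nhds hy)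
      filter_upwards [this] with x' hx' hY
      exact hUy y x' hx' hY)
  let Ψ : V → V := fun x => if h : x ∈ W then g ⟨x, h⟩ else 0
  have hΨ : ∀ x : W, Ψ x = g x := fun x => by simp [Ψ]
  refine ⟨W, W.2, fun y hy => Set.mem_iUnion.2 ⟨⟨y, hy⟩, hyU ⟨y, hy⟩⟩, Ψ, ?_, ?_⟩
  · intro x hx
    have h2 : ContMDiffAt 𝓘(ℝ, V) 𝓘(ℝ, V) ∞ (fun x : W => Ψ x) ⟨x, hx⟩ := by
      have : (fun x : W => Ψ x) = g := funext hΨ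
      rw [this]
      exact g.contMDiff ⟨x, hx⟩
    have h3 := contMDiffAt_subtype_iff.1 h2
    exact (h3.contDiffAt.differentiableAt (by simp)).differentiableWithinAt
  · intro x hx
    have hxW : x ∈ W := Set.mem_iUnion.2 ⟨⟨x, hx⟩, hyU ⟨x, hx⟩⟩
    have := hg ⟨x, hxW⟩ hx
    rw [hΨ ⟨x, hxW⟩]
    exact this

theorem exists_dist_fun {V : Type*} [NormedAddCommGroup V] (A : Set V) (hA : IsClosed A) :
    ∃ d : V → ℝ, Continuous d ∧ (∀ x, 0 ≤ d x) ∧ ∀ x, d x = 0 ↔ x ∈ A := by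
  rcases A.eq_empty_or_nonempty with rfl | hne
  · exact ⟨fun _ => 1, continuous_const, fun _ => zero_le_one, by simp⟩
  · exact ⟨fun x => Metric.infDist x A, Metric.continuous_infDist_pt A,
      fun x => Metric.infDist_nonneg, fun x => (hA.mem_iff_infDist_zero hne).symm⟩

/-- the un-normalised deformed position -/
noncomputable def prv (z : V) (r : ℝ) (p x : V) : V :=
  (x - z) - ((r - ‖x - z‖) / (r - ‖p - z‖)) • (p - z)

/-- Retraction of a punctured ball onto its sphere. -/
noncomputable def prj (z : V) (r : ℝ) (p x : V) : V :=
  z + (r / ‖prv z r p x‖) • prv z r p x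

theorem prv_ne {z p x : V} {r : ℝ} (hr : 0 < r) (hp : ‖p - z‖ ≤ r / 2) (hx : ‖x - z‖ < r)
    (hxp : x ≠ p) : prv z r p x ≠ 0 := by
  intro h
  have hq : 0 < r - ‖p - z‖ := by linarith
  set t := (r - ‖x - z‖) / (r - ‖p - z‖) with ht
  have h1 : x - z = t • (p - z) := sub_eq_zero.1 h
  have ht0 : 0 ≤ t := div_nonneg (by linarith) hq.le
  have h2 : ‖x - z‖ = t * ‖p - z‖ := by rw [h1, norm_smul, Real.norm_of_nonneg ht0]
  have h3 : t * (r - ‖p - z‖) = r - ‖x - z‖ := by rw [ht]; field_simp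
  have h4 : t * r = 1 * r := by linarith
  have h5 : t = 1 := mul_right_cancel₀ hr.ne' h4
  rw [h5, one_smul] at h1
  exact hxp (sub_left_injective h1)

theorem prj_sphere {z p x : V} {r : ℝ} (hr : 0 < r) (hp : ‖p - z‖ ≤ r / 2) (hx : ‖x - z‖ < r)
    (hxp : x ≠ p) : prj z r p x ∈ Metric.sphere z r := by
  have h := norm_pos_iff.2 (prv_ne hr hp hx hxp)
  rw [mem_sphere_iff_norm, prj, add_sub_cancel_left, norm_smul, norm_div, norm_norm,
    Real.norm_of_nonneg hr.le]
  field_simp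

theorem prj_dist {z p x : V} {r : ℝ} (hr : 0 < r) (hp : ‖p - z‖ ≤ r / 2) (hx : ‖x - z‖ < r)
    (hxp : x ≠ p) : ‖prj z r p x - x‖ ≤ 3 * (r - ‖x - z‖) := by
  have h := norm_pos_iff.2 (prv_ne hr hp hx hxp)
  have hq : 0 < r - ‖p - z‖ := by linarith
  have e1 : ‖prv z r p x - (x - z)‖ ≤ r - ‖x - z‖ := by
    rw [prv, sub_sub_cancel_left, norm_neg, norm_smul, Real.norm_of_nonneg
      (div_nonneg (by linarith) hq.le), div_mul_eq_mul_div, div_le_iff₀ hq]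
    exact mul_le_mul_of_nonneg_left (by linarith) (by linarith)
  have e2 : ‖(r / ‖prv z r p x‖) • prv z r p x - prv z r p x‖ = |r - ‖prv z r p x‖| := by
    have : (r / ‖prv z r p x‖) • prv z r p x - prv z r p x =
        ((r - ‖prv z r p x‖) / ‖prv z r p x‖) • prv z r p x := by
      rw [sub_div, div_self h.ne', sub_smul, one_smul]
    rw [this, norm_smul, norm_div, norm_norm, Real.norm_eq_abs]
    field_simp
  have e3 : |r - ‖prv z r p x‖| ≤ 2 * (r - ‖x - z‖) := by
    have := abs_norm_sub_norm_le (prv z r p x) (x - z)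
    rw [abs_le] at *
    constructor <;> linarith
  have : prj z r p x - x = ((r / ‖prv z r p x‖) • prv z r p x - prv z r p x) +
      (prv z r p x - (x - z)) := by rw [prj]; abel
  rw [this]
  refine (norm_add_le _ _).trans ?_
  rw [e2]; linarith

theorem prj_cont {z p x : V} {r : ℝ} (hr : 0 < r) (hp : ‖p - z‖ ≤ r / 2) (hx : ‖x - z‖ < r)
    (hxp : x ≠ p) : ContinuousAt (prj z r p) x := by
  have h := norm_pos_iff.2 (prv_ne hr hp hx hxp)
  have hc : ContinuousAt (prv z r p) x := by
    unfold prv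
    fun_prop
  unfold prj
  exact continuousAt_const.add ((continuousAt_const.div hc.norm h.ne').smul hc)

open Classical in
/-- Simultaneous retraction for a family of disjoint balls. -/
noncomputable def fam {β : Type*} (c : β → V) (r : β → ℝ) (p : β → V) (t : Set β) (x : V) : V :=
  if h : ∃ j ∈ t, x ∈ Metric.ball (c j) (r j) then prj (c h.choose) (r h.choose) (p h.choose) x
  else x

theorem fam_out {β : Type*} (c : β → V) (r : β → ℝ) (p : β → V) (t : Set β) (x : V)
    (h : ∀ j ∈ t, x ∉ Metric.ball (c j) (r j)) : fam c r p t x = x := by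
  unfold fam
  rw [dif_neg]
  rintro ⟨j, hj, hx⟩
  exact h j hj hx

theorem fam_in {β : Type*} (c : β → V) (r : β → ℝ) (p : β → V) (t : Set β)
    (ht : t.PairwiseDisjoint fun j => Metric.closedBall (c j) (r j)) (x : V)
    (j : β) (hj : j ∈ t) (hx : x ∈ Metric.ball (c j) (r j)) :
    fam c r p t x = prj (c j) (r j) (p j) x := by
  have h : ∃ j ∈ t, x ∈ Metric.ball (c j) (r j) := ⟨j, hj, hx⟩
  unfold fam
  rw [dif_pos h]
  have : h.choose = j := by
    by_contra hne
    have := ht h.choose_spec.1 hj hne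
    exact Set.disjoint_left.1 this (Metric.ball_subset_closedBall h.choose_spec.2)
      (Metric.ball_subset_closedBall hx)
  rw [this]

theorem fam_cont {β : Type*} (c : β → V) (r : β → ℝ) (p : β → V) (t : Set β)
    (ht : t.PairwiseDisjoint fun j => Metric.closedBall (c j) (r j))
    (hr : ∀ j, 0 < r j) (hp : ∀ j, ‖p j - c j‖ ≤ r j / 2) (Y : Set V)
    (hY : ∀ j, p j ∉ Y) : ContinuousOn (fam c r p t) Y := by
  intro x hxY
  by_cases h : ∃ j ∈ t, x ∈ Metric.ball (c j) (r j)
  · obtain ⟨j, hj, hx⟩ := h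
    refine ContinuousAt.continuousWithinAt ?_
    have hxp : x ≠ p j := fun h => hY j (h ▸ hxY)
    refine (prj_cont (hr j) (hp j) (mem_ball_iff_norm.1 hx) hxp).congr ?_
    filter_upwards [Metric.isOpen_ball.mem_nhds hx] with y hy
    exact (fam_in c r p t ht y j hj hy).symm
  · push Not at h
    have hb : ∀ y ∈ Y, ‖fam c r p t y - y‖ ≤ 3 * ‖y - x‖ := by
      intro y hyY
      by_cases h' : ∃ j ∈ t, y ∈ Metric.ball (c j) (r j)
      · obtain ⟨j, hj, hy⟩ := h'
        rw [fam_in c r p t ht y j hj hy]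
        have hyp : y ≠ p j := fun h => hY j (h ▸ hyY)
        refine (prj_dist (hr j) (hp j) (mem_ball_iff_norm.1 hy) hyp).trans ?_
        have h1 := h j hj
        rw [mem_ball_iff_norm, not_lt] at h1
        have h2 : ‖x - c j‖ ≤ ‖y - c j‖ + ‖y - x‖ := by
          have := norm_sub_le (y - c j) (y - x)
          simpa using this
        linarith
      · push Not at h'
        rw [fam_out c r p t y h']
        simp
    rw [Metric.continuousWithinAt_iff]
    intro ε hε
    refine ⟨ε / 4, by positivity, fun y hy hyx => ?_⟩
    rw [fam_out c r p t x h, dist_eq_norm]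
    rw [dist_eq_norm] at hyx
    have h3 := hb y hy
    have h4 : ‖fam c r p t y - x‖ ≤ ‖fam c r p t y - y‖ + ‖y - x‖ := by
      have := norm_add_le (fam c r p t y - y) (y - x)
      simpa using this
    linarith

theorem list_retract {β : Type*} (c : β → V) (r : β → ℝ) (p : β → V)
    (hr : ∀ j, 0 < r j) (hp : ∀ j, ‖p j - c j‖ ≤ r j / 2) (E S : Set V)
    (hE : ∀ j, p j ∉ E) (hS : ∀ j, p j ∉ S) (L : List (Set β)) :
    (∀ t ∈ L, t.PairwiseDisjoint fun j => Metric.closedBall (c j) (r j)) →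
    (∀ t ∈ L, ∀ j ∈ t, Metric.sphere (c j) (r j) ⊆ S) →
    ∃ h : V → V, ContinuousOn h E ∧
      (∀ x ∈ E, (∀ t ∈ L, ∀ j ∈ t, x ∉ Metric.ball (c j) (r j)) → h x = x) ∧
      ∀ x ∈ E, h x ∈ S ∨ (h x = x ∧ ∀ t ∈ L, ∀ j ∈ t, x ∉ Metric.ball (c j) (r j)) := by
  induction L with
  | nil =>
    intro _ _
    exact ⟨id, continuousOn_id, fun _ _ _ => rfl, fun x _ => Or.inr ⟨rfl, by simp⟩⟩
  | cons t L ih =>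
    intro h1 h2
    obtain ⟨h, hc, ha, hb⟩ := ih (fun t' ht' => h1 t' (List.mem_cons_of_mem _ ht'))
      (fun t' ht' => h2 t' (List.mem_cons_of_mem _ ht'))
    have ht := h1 t List.mem_cons_self
    have hmaps : Set.MapsTo h E (E ∪ S) := by
      intro x hx
      rcases hb x hx with h | h
      · exact Or.inr h
      · rw [h.1]; exact Or.inl hx
    have hY : ∀ j, p j ∉ E ∪ S := fun j h => h.elim (hE j) (hS j)
    refine ⟨fam c r p t ∘ h, (fam_cont c r p t ht hr hp (E ∪ S) hY).comp hc hmaps, ?_, ?_⟩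
    · intro x hx hout
      have e := ha x hx (fun t' ht' => hout t' (List.mem_cons_of_mem _ ht'))
      rw [Function.comp_apply, e]
      exact fam_out c r p t x (hout t List.mem_cons_self)
    · intro x hx
      by_cases hin : ∃ j ∈ t, h x ∈ Metric.ball (c j) (r j)
      · obtain ⟨j, hj, hxj⟩ := hin
        left
        rw [Function.comp_apply, fam_in c r p t ht _ j hj hxj]
        refine h2 t List.mem_cons_self j hj (prj_sphere (hr j) (hp j) (mem_ball_iff_norm.1 hxj) ?_)
        intro he
        exact hY j (he ▸ hmaps hx)
      · push Not at hin
        rw [Function.comp_apply, fam_out c r p t _ hin]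
        rcases hb x hx with h' | h'
        · exact Or.inl h'
        · right
          refine ⟨h'.1, ?_⟩
          rw [h'.1] at hin
          intro t' ht'
          rcases List.mem_cons.1 ht' with rfl | ht'
          · exact hin
          · exact h'.2 t' ht'

theorem exists_global [FiniteDimensional ℝ V] (E : Set V) (f : V → V) (hf : ContinuousOn f E) :
    ∃ G : V → V, Continuous G ∧ ∀ x ∈ E, f x ≠ 0 →
      G x ≠ 0 ∧ 1 / 2 * ‖G x‖ * ‖f x‖ ≤ inner ℝ (G x) (f x) := by
  have hΦ : ContinuousOn (fun x => ‖f x‖⁻¹ • f x) (E ∩ {x | f x ≠ 0}) := by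
    have h1 : ContinuousOn f (E ∩ {x | f x ≠ 0}) := hf.mono Set.inter_subset_left
    exact (h1.norm.inv₀ (fun x hx => norm_ne_zero_iff.2 hx.2)).smul h1
  obtain ⟨W, hW, hYW, Ψ, hΨ, happ⟩ := smooth_approx _ _ hΦ (δ := 1 / 4) (by norm_num)
  obtain ⟨d, hd, hd0, hdz⟩ := exists_dist_fun Wᶜ hW.isClosed_compl
  have hm : ∀ x, 0 < max 1 ‖Ψ x‖ := fun x => lt_of_lt_of_le one_pos (le_max_left _ _)
  refine ⟨fun x => (d x / max 1 ‖Ψ x‖) • Ψ x, ?_, ?_⟩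
  · rw [continuous_iff_continuousAt]
    intro x
    by_cases hx : x ∈ W
    · have h1 : ContinuousAt Ψ x := (hΨ.differentiableAt (hW.mem_nhds hx)).continuousAt
      exact (hd.continuousAt.div (continuousAt_const.max h1.norm) (hm x).ne').smul h1
    · have hdx : d x = 0 := (hdz x).2 hx
      have hb : ∀ y, ‖(d y / max 1 ‖Ψ y‖) • Ψ y‖ ≤ d y := by
        intro y
        rw [norm_smul, norm_div, Real.norm_of_nonneg (hd0 y), Real.norm_of_nonneg (hm y).le,
          div_mul_eq_mul_div, div_le_iff₀ (hm y)]
        exact mul_le_mul_of_nonneg_left (le_max_right _ _) (hd0 y)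
      rw [ContinuousAt]
      simp only [hdx, zero_div, zero_smul]
      refine squeeze_zero_norm hb ?_
      have := hd.tendsto x
      rwa [hdx] at this
  · intro x hx hfx
    have hdx : 0 < d x := by
      refine lt_of_le_of_ne (hd0 x) (fun h => ?_)
      exact (hdz x).1 h.symm (hYW ⟨hx, hfx⟩)
    have hk : 0 < d x / max 1 ‖Ψ x‖ := div_pos hdx (hm x)
    have hn : 0 < ‖f x‖ := norm_pos_iff.2 hfx
    have ha := happ x ⟨hx, hfx⟩
    set e := ‖f x‖⁻¹ • f x with he
    have hfe : f x = ‖f x‖ • e := by rw [he, smul_smul, mul_inv_cancel₀ hn.ne', one_smul]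
    have hen : ‖e‖ = 1 := by rw [he, norm_smul, norm_inv, norm_norm, inv_mul_cancel₀ hn.ne']
    have h1 : ‖Ψ x‖ ≤ 5 / 4 := by
      have := norm_sub_norm_le (Ψ x) e
      linarith
    have h2 : 3 / 4 ≤ inner ℝ (Ψ x) e := by
      have h3 : inner ℝ (Ψ x) e = 1 + inner ℝ (Ψ x - e) e := by
        rw [inner_sub_left, real_inner_self_eq_norm_sq, hen]; ring
      have h4 := abs_real_inner_le_norm (Ψ x - e) e
      rw [hen, mul_one] at h4
      have := (abs_le.1 h4).1
      linarith
    constructor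
    · refine smul_ne_zero hk.ne' (fun h => ?_)
      rw [h, inner_zero_left] at h2
      norm_num at h2
    · rw [norm_smul, Real.norm_of_nonneg hk.le]
      have h5 : inner ℝ ((d x / max 1 ‖Ψ x‖) • Ψ x) (f x) =
          (d x / max 1 ‖Ψ x‖) * (‖f x‖ * inner ℝ (Ψ x) e) := by
        rw [real_inner_smul_left]
        nth_rewrite 1 [hfe]
        rw [real_inner_smul_right]
      rw [h5]
      have h6 : 1 / 2 * ‖Ψ x‖ * ‖f x‖ ≤ ‖f x‖ * inner ℝ (Ψ x) e := by
        nlinarith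
      calc _ = (d x / max 1 ‖Ψ x‖) * (1 / 2 * ‖Ψ x‖ * ‖f x‖) := by ring
        _ ≤ _ := mul_le_mul_of_nonneg_left h6 hk.le

open MeasureTheory in
theorem core_dir [FiniteDimensional ℝ V] [MeasurableSpace V] [BorelSpace V]
    (E : Set V) (f : V → V) (hf : ContinuousOn f E)
    (hf0 : ∀ x ∈ interior E, f x ≠ 0) {ε : ℝ} (hε : 0 < ε) :
    ∃ u : V → V, ContinuousOn u E ∧ (∀ x ∈ E, u x ≠ 0) ∧
      ∀ x ∈ E, ε ≤ ‖f x‖ → 0 < inner ℝ (u x) (f x) := by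
  classical
  have : ProperSpace V := FiniteDimensional.proper_real V
  obtain ⟨G, hG, hGf⟩ := exists_global E f hf
  set T : Set V := closure {x | x ∈ E ∧ ε ≤ ‖f x‖} with hT
  have hTE : ∀ x ∈ E, x ∈ T → ε ≤ ‖f x‖ := by
    intro x hx hxT
    by_contra hlt
    rw [not_le] at hlt
    have := (hf x hx).norm.eventually (gt_mem_nhds hlt)
    obtain ⟨U, hU, hxU, hUE⟩ := mem_nhdsWithin.1 this
    obtain ⟨y, hyU, hyE, hy⟩ := mem_closure_iff.1 hxT U hU hxU
    exact absurd (hUE ⟨hyU, hyE⟩) (not_lt.2 hy)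
  have hET : ∀ x ∈ E, ε ≤ ‖f x‖ → x ∈ T := fun x hx h => subset_closure ⟨hx, h⟩
  obtain ⟨P, hPE, hPc, hPd⟩ :=
    (TopologicalSpace.IsSeparable.of_separableSpace Eᶜ).exists_countable_dense_subset
  let β := {z : V // G z = 0 ∧ z ∉ T}
  have hrad : ∀ z : β, ∃ r : ℝ, 0 < r ∧ r ≤ 1 ∧ Metric.closedBall (z : V) r ⊆ Tᶜ ∧
      ∀ q ∈ P, dist q z ≠ r := by
    intro z
    obtain ⟨ρ, hρ, hball⟩ := Metric.nhds_basis_closedBall.mem_iff.1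
      (isClosed_closure.isOpen_compl.mem_nhds (show (z : V) ∈ Tᶜ from z.2.2))
    have hcount : ((fun q => dist q (z : V)) '' P).Countable := hPc.image _
    obtain ⟨r, hr, hrm⟩ := (hcount.dense_compl ℝ).exists_mem_open isOpen_Ioo
      (Set.nonempty_Ioo.2 (lt_min hρ one_pos))
    refine ⟨r, hrm.1, hrm.2.le.trans (min_le_right _ _),
      (Metric.closedBall_subset_closedBall (hrm.2.le.trans (min_le_left _ _))).trans hball, ?_⟩
    intro q hq h
    exact hr ⟨q, hq, h⟩
  choose r hr0 hr1 hrT hrP using hrad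
  have hp : ∀ z : β, ∃ p ∈ P, ‖p - z‖ ≤ r z / 2 := by
    intro z
    have hz : (z : V) ∉ interior E := fun h =>
      (hGf z (interior_subset h) (hf0 z h)).1 z.2.1
    have hz' : (z : V) ∈ closure P := by
      have : (z : V) ∈ closure Eᶜ := by rwa [closure_compl]
      exact closure_minimal hPd isClosed_closure this
    obtain ⟨p, hpP, hp⟩ := Metric.mem_closure_iff.1 hz' (r z / 2) (half_pos (hr0 z))
    refine ⟨p, hpP, ?_⟩
    rw [dist_comm, dist_eq_norm] at hp
    exact hp.le
  choose p hpP hpz using hp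
  obtain ⟨M, τ, hτ, hM⟩ := HasBesicovitchCovering.no_satelliteConfig (α := V)
  obtain ⟨s, hs, hcov⟩ := Besicovitch.exist_disjoint_covering_families hτ hM
    (⟨fun z : β => (z : V), r, hr0, 1, hr1⟩ : Besicovitch.BallPackage β V)
  simp only at hs hcov
  set S : Set V := ⋃ i, ⋃ j ∈ s i, Metric.sphere (j : V) (r j) with hS
  set D : Set V := ⋃ i, ⋃ j ∈ s i, Metric.ball (j : V) (r j) with hD
  have hST : ∀ x ∈ S, x ∉ T := by
    intro x hx
    simp only [hS, Set.mem_iUnion] at hx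
    obtain ⟨i, j, hj, hx⟩ := hx
    exact hrT j (Metric.sphere_subset_closedBall hx)
  have hDT : ∀ x ∈ D, x ∉ T := by
    intro x hx
    simp only [hD, Set.mem_iUnion] at hx
    obtain ⟨i, j, hj, hx⟩ := hx
    exact hrT j (Metric.ball_subset_closedBall hx)
  have hDo : IsOpen D := isOpen_iUnion fun i => isOpen_biUnion fun j _ => Metric.isOpen_ball
  have hZD : ∀ x, G x = 0 → x ∉ T → x ∈ D := fun x h1 h2 => hcov ⟨⟨x, h1, h2⟩, rfl⟩
  obtain ⟨h, hc, hfix, him⟩ := list_retract (fun z : β => (z : V)) r p hr0 hpz E S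
    (fun j hj => hPE (hpP j) hj) (fun j hj => by
      simp only [hS, Set.mem_iUnion] at hj
      obtain ⟨i, k, hk, hx⟩ := hj
      exact hrP k (p j) (hpP j) hx) (List.ofFn s) (by
      intro t ht
      obtain ⟨i, rfl⟩ := List.mem_ofFn.1 ht
      exact hs i) (by
      intro t ht j hj x hx
      obtain ⟨i, rfl⟩ := List.mem_ofFn.1 ht
      simp only [hS, Set.mem_iUnion]
      exact ⟨i, j, hj, hx⟩)
  have hout : ∀ x, (∀ t ∈ List.ofFn s, ∀ j ∈ t, x ∉ Metric.ball (j : V) (r j)) ↔ x ∉ D := by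
    intro x
    simp only [hD, Set.mem_iUnion, List.mem_ofFn]
    constructor
    · rintro h ⟨i, j, hj, hx⟩
      exact h _ ⟨i, rfl⟩ j hj hx
    · rintro h t ⟨i, rfl⟩ j hj hx
      exact h ⟨i, j, hj, hx⟩
  obtain ⟨d, hd, hd0, hdz⟩ := exists_dist_fun Dᶜ hDo.isClosed_compl
  set μ : V → ℝ := fun x => ‖G x‖ + d x with hμ
  have hμc : Continuous μ := hG.norm.add hd
  have hμ0 : ∀ x, μ x = 0 → G x = 0 ∧ x ∉ D := by
    intro x hx
    have h1 := norm_nonneg (G x)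
    have h2 := hd0 x
    have h3 : ‖G x‖ + d x = 0 := hx
    exact ⟨norm_eq_zero.1 (by linarith), (hdz x).1 (by linarith)⟩
  have hSW : ∀ x ∈ S, μ x ≠ 0 := fun x hx h =>
    (hμ0 x h).2 (hZD x (hμ0 x h).1 (hST x hx))
  have hEW : ∀ x ∈ E, μ x ≠ 0 := by
    intro x hx h
    by_cases hxT : x ∈ T
    · have h1 := hTE x hx hxT
      exact (hGf x hx (norm_pos_iff.1 (hε.trans_le h1))).1 (hμ0 x h).1
    · exact (hμ0 x h).2 (hZD x (hμ0 x h).1 hxT)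
  have hΦ : ContinuousOn (fun x => (μ x)⁻¹ • G x) {x | μ x ≠ 0} :=
    (hμc.continuousOn.inv₀ fun x hx => hx).smul hG.continuousOn
  obtain ⟨W, hW, hYW, Ψ, hΨ, happ⟩ := smooth_approx _ _ hΦ (δ := 1 / 4) (by norm_num)
  have hvS : (volume : Measure V) S = 0 := by
    rw [hS, measure_iUnion_null_iff]
    intro i
    have hcount : (s i).Countable := (hs i).countable_of_nonempty_interior fun j _ =>
      (Metric.nonempty_ball.2 (hr0 j)).mono Metric.ball_subset_interior_closedBall
    rw [measure_biUnion_null_iff hcount]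
    intro j _
    exact Measure.addHaar_sphere_of_ne_zero _ _ (hr0 j).ne'
  have hvΨ : (volume : Measure V) (Ψ '' S) = 0 :=
    addHaar_image_eq_zero_of_differentiableOn_of_addHaar_eq_zero _
      (hΨ.mono fun x hx => hYW (hSW x hx)) hvS
  obtain ⟨c, hcb, hcS⟩ : ∃ c ∈ Metric.ball (0 : V) (1 / 4), c ∉ Ψ '' S := by
    by_contra hcon
    push Not at hcon
    have h1 : (volume : Measure V) (Metric.ball (0 : V) (1 / 4)) = 0 :=
      measure_mono_null hcon hvΨ
    exact (Metric.measure_ball_pos volume (0 : V) (by norm_num : (0:ℝ) < 1 / 4)).ne' h1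
  rw [mem_ball_zero_iff] at hcb
  have hunit : ∀ x ∈ E, x ∉ D → μ x = ‖G x‖ := by
    intro x hx hxD
    have : d x = 0 := (hdz x).2 hxD
    simp [hμ, this]
  refine ⟨fun x => Ψ (h x) - c, ?_, ?_, ?_⟩
  · refine ContinuousOn.sub (hΨ.continuousOn.comp hc ?_) continuousOn_const
    intro x hx
    rcases him x hx with h1 | h1
    · exact hYW (hSW _ h1)
    · rw [h1.1]; exact hYW (hEW x hx)
  · intro x hx h0
    change Ψ (h x) - c = 0 at h0
    rcases him x hx with h1 | h1
    · exact hcS ⟨h x, h1, sub_eq_zero.1 h0⟩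
    · rw [h1.1] at h0
      have h2 := happ x (hEW x hx)
      rw [sub_eq_zero.1 h0] at h2
      have h3 := hunit x hx ((hout x).1 h1.2)
      have h4 := hEW x hx
      have h5 : ‖(μ x)⁻¹ • G x‖ = 1 := by
        rw [norm_smul, norm_inv, Real.norm_eq_abs, h3, abs_norm]
        rw [h3] at h4
        exact inv_mul_cancel₀ h4
      have h6 := norm_sub_norm_le ((μ x)⁻¹ • G x) c
      rw [norm_sub_rev, h5] at h6
      linarith
  · intro x hx hfx
    have hxD : x ∉ D := fun h => hDT x h (hET x hx hfx)
    have hxx : h x = x := hfix x hx ((hout x).2 hxD)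
    have h2 := happ x (hEW x hx)
    have h3 := hunit x hx hxD
    have h4 := hEW x hx
    have hn : 0 < ‖f x‖ := hε.trans_le hfx
    have h7 := (hGf x hx (norm_pos_iff.1 hn)).2
    have hGp : 0 < ‖G x‖ := norm_pos_iff.2 (hGf x hx (norm_pos_iff.1 hn)).1
    have h8 : 1 / 2 * ‖f x‖ ≤ inner ℝ ((μ x)⁻¹ • G x) (f x) := by
      rw [real_inner_smul_left, h3, inv_mul_eq_div, le_div_iff₀ hGp]
      linarith
    set w := Ψ x - c - (μ x)⁻¹ • G x with hw
    have h9 : ‖w‖ < 1 / 2 := by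
      have : w = (Ψ x - (μ x)⁻¹ • G x) - c := by rw [hw]; abel
      rw [this]
      have := norm_sub_le (Ψ x - (μ x)⁻¹ • G x) c
      linarith
    have h10 : Ψ x - c = (μ x)⁻¹ • G x + w := by rw [hw]; abel
    change 0 < inner ℝ (Ψ (h x) - c) (f x)
    rw [hxx, h10, inner_add_left]
    have h11 := (abs_le.1 (abs_real_inner_le_norm w (f x))).1
    nlinarith

theorem contOn_max {X : Type*} [TopologicalSpace X] {a b : X → ℝ} {s : Set X}
    (ha : ContinuousOn a s) (hb : ContinuousOn b s) :
    ContinuousOn (fun x => max (a x) (b x)) s := fun x hx => Filter.Tendsto.max (ha x hx) (hb x hx)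

theorem nonzero_approx [FiniteDimensional ℝ V] [MeasurableSpace V] [BorelSpace V]
    (E : Set V) (f : V → V) (hf : ContinuousOn f E)
    (hf0 : ∀ x ∈ interior E, f x ≠ 0) {ε : ℝ} (hε : 0 < ε) :
    ∃ δ : ℝ, 0 < δ ∧ ∃ F : V → V, ContinuousOn F E ∧ ∀ x ∈ E, δ ≤ ‖F x‖ ∧ ‖f x - F x‖ < ε := by
  obtain ⟨δ, hδ, hδε⟩ : ∃ δ : ℝ, 0 < δ ∧ 3 * δ < ε := ⟨ε / 4, by positivity, by linarith⟩
  obtain ⟨u, hu, hu0, hui⟩ := core_dir E f hf hf0 hδ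
  have hm : ∀ x, 0 < max ‖f x‖ δ := fun x => lt_of_lt_of_le hδ (le_max_right _ _)
  let a : V → ℝ := fun x => max (‖f x‖ - δ) 0 / max ‖f x‖ δ
  let H : V → V := fun x => (δ / ‖u x‖) • u x + a x • f x
  have ha : ContinuousOn a E :=
    (contOn_max (a := fun x => ‖f x‖ - δ) (hf.norm.sub continuousOn_const)
      continuousOn_const).div (contOn_max hf.norm continuousOn_const) (fun x _ => (hm x).ne')
  have hH : ContinuousOn H E :=
    ((continuousOn_const.div hu.norm fun x hx => norm_ne_zero_iff.2 (hu0 x hx)).smul hu).add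
      (ha.smul hf)
  have ha0 : ∀ x, 0 ≤ a x := fun x => div_nonneg (le_max_right _ _) (hm x).le
  have hun : ∀ x ∈ E, ‖(δ / ‖u x‖) • u x‖ = δ := by
    intro x hx
    have := norm_pos_iff.2 (hu0 x hx)
    rw [norm_smul, norm_div, norm_norm, Real.norm_of_nonneg hδ.le]
    field_simp
  have hH0 : ∀ x ∈ E, H x ≠ 0 := by
    intro x hx h
    rcases le_or_gt δ ‖f x‖ with h1 | h1
    · have h2 := hui x hx h1
      have h3 : inner ℝ (H x) (f x) = δ / ‖u x‖ * inner ℝ (u x) (f x) + a x * ‖f x‖ ^ 2 := by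
        simp only [H]
        rw [inner_add_left, real_inner_smul_left, real_inner_smul_left, real_inner_self_eq_norm_sq]
      rw [h, inner_zero_left] at h3
      have h4 : 0 < δ / ‖u x‖ * inner ℝ (u x) (f x) :=
        mul_pos (div_pos hδ (norm_pos_iff.2 (hu0 x hx))) h2
      have h5 : 0 ≤ a x * ‖f x‖ ^ 2 := mul_nonneg (ha0 x) (sq_nonneg _)
      linarith
    · have h2 : a x = 0 := by
        simp only [a]; rw [max_eq_right (by linarith), zero_div]
      have h3 := hun x hx
      simp only [H, h2, zero_smul, add_zero] at h
      rw [h, norm_zero] at h3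
      linarith
  have hHf : ∀ x ∈ E, ‖f x - H x‖ ≤ 2 * δ := by
    intro x hx
    have h1 : ‖f x - a x • f x‖ ≤ δ := by
      have : f x - a x • f x = (1 - a x) • f x := by rw [sub_smul, one_smul]
      rw [this, norm_smul]
      rcases le_or_gt δ ‖f x‖ with h1 | h1
      · have h0 : 0 < ‖f x‖ := hδ.trans_le h1
        have h2 : 1 - a x = δ / ‖f x‖ := by
          simp only [a]; rw [max_eq_left (by linarith), max_eq_left h1]; field_simp; ring
        rw [h2, norm_div, norm_norm, Real.norm_of_nonneg hδ.le]
        field_simp; exact le_rfl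
      · have h2 : a x = 0 := by
          simp only [a]; rw [max_eq_right (by linarith), zero_div]
        rw [h2]; simpa using h1.le
    have h2 : f x - H x = (f x - a x • f x) - (δ / ‖u x‖) • u x := by
      simp only [H]; abel
    rw [h2]
    refine (norm_sub_le _ _).trans ?_
    rw [hun x hx]; linarith
  refine ⟨δ, hδ, fun x => max 1 (δ / ‖H x‖) • H x, ?_, ?_⟩
  · exact (contOn_max (b := fun x => δ / ‖H x‖) continuousOn_const (continuousOn_const.div hH.norm
      fun x hx => norm_ne_zero_iff.2 (hH0 x hx))).smul hH
  · intro x hx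
    have hp : 0 < ‖H x‖ := norm_pos_iff.2 (hH0 x hx)
    have hk : 0 < max 1 (δ / ‖H x‖) := lt_of_lt_of_le one_pos (le_max_left _ _)
    constructor
    · rw [norm_smul, Real.norm_of_nonneg hk.le, ← div_le_iff₀ hp]
      exact le_max_right _ _
    · have h1 : ‖H x - max 1 (δ / ‖H x‖) • H x‖ ≤ δ := by
        have : H x - max 1 (δ / ‖H x‖) • H x = (1 - max 1 (δ / ‖H x‖)) • H x := by
          rw [sub_smul, one_smul]
        rw [this, norm_smul, norm_sub_rev, Real.norm_of_nonneg (by simp)]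
        rw [← le_div_iff₀ hp, sub_le_iff_le_add]
        have : 0 ≤ δ / ‖H x‖ := by positivity
        exact max_le (by linarith) (by linarith)
      have h2 := norm_add_le (f x - H x) (H x - max 1 (δ / ‖H x‖) • H x)
      rw [sub_add_sub_cancel] at h2
      have := hHf x hx
      linarith

end topo

/-- **Lemma 1 of the paper.** Given `E ⊆ ℝⁿ` and a continuous `f : E → ℝⁿ`
zero-free on the interior of `E`, and `ε > 0`, there are a locally finite
geometric simplicial complex `K` in some `ℝᴺ` of dimension at most `n`, a
continuous map `h : E → |K|`, and a continuous `g : |K| → ℝⁿ` that is zero-free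
on each `n`-simplex of `K`, with `‖f - g ∘ h‖_E < ε`. -/
theorem factor_through_polytope (n : ℕ) (hn : 1 ≤ n)
    (E : Set (EuclideanSpace ℝ (Fin n)))
    (f : E → EuclideanSpace ℝ (Fin n)) (hf : Continuous f)
    (hf0 : ∀ x : E, (x : EuclideanSpace ℝ (Fin n)) ∈ interior E → f x ≠ 0)
    (ε : ℝ) (hε : 0 < ε) :
    ∃ (N : ℕ) (K : SimplicialComplex ℝ (EuclideanSpace ℝ (Fin N)))
      (h : E → K.space) (g : K.space → EuclideanSpace ℝ (Fin n)),
      (LocallyFinite fun s : K.faces =>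
        convexHull ℝ ((s : Finset (EuclideanSpace ℝ (Fin N))) : Set (EuclideanSpace ℝ (Fin N)))) ∧
      (∀ s ∈ K.faces, s.card ≤ n + 1) ∧
      Continuous h ∧ Continuous g ∧
      (∀ s ∈ K.faces, s.card = n + 1 →
        ∀ y : K.space, (y : EuclideanSpace ℝ (Fin N)) ∈
          convexHull ℝ ((s : Finset (EuclideanSpace ℝ (Fin N))) : Set (EuclideanSpace ℝ (Fin N))) →
          g y ≠ 0) ∧
      ∀ x : E, ‖f x - g (h x)‖ < ε := by
  classical
  let f' : EuclideanSpace ℝ (Fin n) → EuclideanSpace ℝ (Fin n) :=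
    fun x => if h : x ∈ E then f ⟨x, h⟩ else 0
  have hf' : ∀ x : E, f' x = f x := fun x => by simp [f']
  have hc : ContinuousOn f' E := by
    rw [continuousOn_iff_continuous_domRestrict]
    have : E.domRestrict f' = f := funext hf'
    rw [this]; exact hf
  obtain ⟨δ, hδ, F, hF, hFp⟩ := nonzero_approx E f' hc (fun x hx => by
    have := hf0 ⟨x, interior_subset hx⟩ hx
    rwa [← hf'] at this) hε
  have hR : 0 < ((n : ℝ) + 1) / δ := by positivity
  set R := ((n : ℝ) + 1) / δ with hRdef
  have hmem : ∀ x : E, R • F x ∈ (kuhnK n).space := by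
    intro x
    apply kuhnK_mem
    rw [norm_smul, Real.norm_of_nonneg hR.le]
    have h1 : R * δ ≤ R * ‖F x‖ := mul_le_mul_of_nonneg_left (hFp x x.2).1 hR.le
    have h2 : R * δ = n + 1 := by rw [hRdef]; field_simp
    linarith
  refine ⟨n, kuhnK n, fun x => ⟨R • F x, hmem x⟩, fun y => R⁻¹ • (y : EuclideanSpace ℝ (Fin n)),
    kuhnK_locallyFinite n, fun s hs => kuhn_card hs.2.1, ?_, ?_, ?_, ?_⟩
  · have h1 : Continuous (fun x : E => F x) := continuousOn_iff_continuous_domRestrict.1 hF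
    exact (h1.const_smul R).subtype_mk _
  · exact continuous_subtype_val.const_smul R⁻¹
  · intro s _ _ y _
    exact smul_ne_zero (inv_ne_zero hR.ne') (kuhnK_zero y.2)
  · intro x
    have h1 := (hFp x x.2).2
    rw [hf'] at h1
    simp only [smul_smul, inv_mul_cancel₀ hR.ne', one_smul]
    exact h1
end
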